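/- Let Φ⁺ ⊂ ℕ² be the set of the 6 vectors (the positive roots of G_2 in simple-root coordinates, with α_1 long and α_2 short): (1,0), (0,1), (1,1), (1,2), (1,3), (2,3). Then in ℤ[[q, y_1, y_2]]: ∏_{c ∈ Φ⁺} ∏_{n≥1} (1 − q^n y_1^{c_1} y_2^{c_2})^{−1} = ∑ over all pairs (r_1, r_2) of descending sequences of q^{E} · y_1^{|r_1|} y_2^{|r_2|} · ∏_{i=1}^{2} ∏_{j≥1} (q;q)_{r_i^{(j)} − r_i^{(j+1)}}^{−1}, where E = ∑_{t≥1} (r_1^{(t)})² + ∑_{t≥1} (r_2^{(t)})² − ∑_{t≥1} r_1^{(t)} ( r_2^{(3t−2)} + r_2^{(3t−1)} + r_2^{(3t)} ); here E is a nonnegative integer. -/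

import Mathlib

section

open MvPowerSeries

/-- The product topology (coefficientwise convergence) on multivariate formal power series. -/
noncomputable instance (σ R : Type*) [TopologicalSpace R] :
    TopologicalSpace (MvPowerSeries σ R) :=
  inferInstanceAs (TopologicalSpace ((σ →₀ ℕ) → R))

/-- `r : ℕ → ℕ` is a descending sequence (indexed so that `r t = r^{(t+1)}`):
nonincreasing and eventually zero. -/
def IsDescending (r : ℕ → ℕ) : Prop :=
  Antitone r ∧ ∃ N, ∀ t ≥ N, r t = 0

/-- The 6 positive roots of `G₂` in simple-root coordinates (with `α₁` long and
`α₂` short). -/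
def posRootsG2 : Finset (Fin 2 → ℕ) :=
  { ![1,0], ![0,1], ![1,1], ![1,2], ![1,3], ![2,3] }

end

namespace G2Identity

open PowerSeries Finset

section QSeries

variable {K : Type*} [Field K]

/-- The sum `∑ j, X ^ j * g j` of power series. -/
noncomputable def shiftSum (g : ℕ → K⟦X⟧) : K⟦X⟧ :=
  PowerSeries.mk fun n => ∑ j ∈ range (n + 1), coeff n (X ^ j * g j)

lemma coeff_shiftSum (g : ℕ → K⟦X⟧) {n N : ℕ} (h : n < N) :
    coeff n (shiftSum g) = ∑ j ∈ range N, coeff n (X ^ j * g j) := by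
  rw [shiftSum, coeff_mk]
  refine sum_subset (by simpa using h) fun j _ hj => ?_
  rw [coeff_X_pow_mul', if_neg (by simpa using hj)]

lemma shiftSum_mul_left (c : K⟦X⟧) (g : ℕ → K⟦X⟧) :
    shiftSum (fun j => c * g j) = c * shiftSum g := by
  ext n
  rw [coeff_mul, coeff_shiftSum _ n.lt_succ_self]
  have : ∀ p ∈ antidiagonal n, coeff p.1 c * coeff p.2 (shiftSum g)
      = ∑ j ∈ range (n + 1), coeff p.1 c * coeff p.2 (X ^ j * g j) := by
    intro p hp
    rw [coeff_shiftSum g (Nat.lt_succ_of_le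
      (HasAntidiagonal.mem_antidiagonal.1 hp ▸ Nat.le_add_left _ _)), mul_sum]
  rw [sum_congr rfl this, sum_comm]
  refine sum_congr rfl fun j _ => ?_
  rw [← coeff_mul, mul_left_comm]

lemma shiftSum_sub (g h : ℕ → K⟦X⟧) :
    shiftSum (fun j => g j - h j) = shiftSum g - shiftSum h := by
  ext n
  simp [shiftSum, mul_sub]

lemma shiftSum_succ (g : ℕ → K⟦X⟧) :
    shiftSum g = g 0 + X * shiftSum (fun j => g (j + 1)) := by
  ext n
  rw [coeff_shiftSum g (n.lt_succ_self.trans n.succ.lt_succ_self), sum_range_succ', map_add,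
    ← shiftSum_mul_left, coeff_shiftSum _ n.lt_succ_self, add_comm]
  simp only [pow_zero, one_mul, pow_succ, mul_assoc]

lemma rescale_shiftSum (a : K) (g : ℕ → K⟦X⟧) :
    rescale a (shiftSum g) = shiftSum (fun j => C (a ^ j) * rescale a (g j)) := by
  ext n
  rw [coeff_rescale, coeff_shiftSum _ n.lt_succ_self, coeff_shiftSum _ n.lt_succ_self, mul_sum]
  refine sum_congr rfl fun j _ => ?_
  rw [← coeff_rescale, map_mul, map_pow, rescale_X, mul_pow, map_pow, mul_assoc, mul_left_comm]

variable (q : K)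

/-- The `q`-Pochhammer symbol `(q;q)_n`. -/
def qPoch (n : ℕ) : K := ∏ i ∈ range n, (1 - q ^ (i + 1))

lemma qPoch_succ (n : ℕ) : qPoch q (n + 1) = qPoch q n * (1 - q ^ (n + 1)) :=
  prod_range_succ _ _

lemma qPoch_ne_zero {q : K} (hq : ∀ n : ℕ, q ^ (n + 1) ≠ 1) (n : ℕ) : qPoch q n ≠ 0 :=
  prod_ne_zero_iff.2 fun i _ => sub_ne_zero.2 (hq i).symm

/-- The kernel `1 / (q;q)_{s-j}`, understood as `0` for `j > s`. -/
noncomputable def kernel (s j : ℕ) : K := if j ≤ s then (qPoch q (s - j))⁻¹ else 0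

/-- One summation `∑ j, q ^ (j² - μ j) e_j X ^ j g_j` of a nested sum. -/
noncomputable def step (e : ℕ → K) (μ : ℤ) (g : ℕ → K⟦X⟧) : K⟦X⟧ :=
  shiftSum fun j => C (q ^ ((j : ℤ) ^ 2 - μ * j) * e j) * g j

/-- The nested sum over `s ≥ r₀ ≥ ⋯ ≥ r_{k-1}` with weights `m` and innermost terms `g`. -/
noncomputable def nested : ℕ → (ℕ → ℤ) → (ℕ → K⟦X⟧) → ℕ → K⟦X⟧
  | 0, _, g => g
  | k + 1, m, g => fun s => step q (kernel q s) (m 0) (nested k (fun t => m (t + 1)) g)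

/-- The nested sum over `r₀ ≥ ⋯ ≥ r_k`, with no upper bound on `r₀`. -/
noncomputable def nestedTop (k : ℕ) (m : ℕ → ℤ) (g : ℕ → K⟦X⟧) : K⟦X⟧ :=
  step q 1 (m 0) (nested q k (fun t => m (t + 1)) g)

/-- The series `1 / ((q;q)_s (qX;q)_s)`. -/
noncomputable def tail (s : ℕ) : K⟦X⟧ :=
  C (qPoch q s)⁻¹ * (∏ i ∈ range s, (1 - C (q ^ (i + 1)) * X))⁻¹

/-- Euler's series `∑ q ^ n X ^ n / (q;q)_n = ∏_{n ≥ 1} (1 - q ^ n X)⁻¹`. -/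
noncomputable def euler : K⟦X⟧ := PowerSeries.mk fun n => q ^ n * (qPoch q n)⁻¹

variable {q}

lemma rescale_step (hq0 : q ≠ 0) (e : ℕ → K) (μ : ℤ) (g : ℕ → K⟦X⟧) :
    rescale q (step q e (μ + 1) g) = step q e μ (fun j => rescale q (g j)) := by
  rw [step, step, rescale_shiftSum]
  congr 1; funext j
  rw [map_mul, ← mul_assoc]
  congr 1
  have : rescale q (C (q ^ ((j : ℤ) ^ 2 - (μ + 1) * j) * e j) : K⟦X⟧)
      = C (q ^ ((j : ℤ) ^ 2 - (μ + 1) * j) * e j) := by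
    ext n; rw [coeff_rescale, coeff_C]; split_ifs with h <;> simp [h]
  rw [this, ← map_mul, ← mul_assoc, ← zpow_natCast q j, ← zpow_add₀ hq0]
  congr 3; ring

lemma rescale_nested (hq0 : q ≠ 0) (k : ℕ) (m : ℕ → ℤ) (g : ℕ → K⟦X⟧) (s : ℕ) :
    rescale q (nested q k (fun t => m t + 1) g s)
      = nested q k m (fun j => rescale q (g j)) s := by
  induction k generalizing m s with
  | zero => rfl
  | succ k ih =>
    simp only [nested]
    rw [rescale_step hq0]
    congr 1; funext j
    exact ih (fun t => m (t + 1)) j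

lemma rescale_nestedTop (hq0 : q ≠ 0) (k : ℕ) (m : ℕ → ℤ) (g : ℕ → K⟦X⟧) :
    rescale q (nestedTop q k (fun t => m t + 1) g)
      = nestedTop q k m (fun j => rescale q (g j)) := by
  rw [nestedTop, rescale_step hq0, nestedTop]
  congr 1; funext j
  exact rescale_nested hq0 k (fun t => m (t + 1)) g j

lemma step_sub (e : ℕ → K) (μ : ℤ) (g h : ℕ → K⟦X⟧) :
    step q e μ (fun j => g j - h j) = step q e μ g - step q e μ h := by
  simp only [step, mul_sub, shiftSum_sub]

lemma nested_sub (k : ℕ) (m : ℕ → ℤ) (g h : ℕ → K⟦X⟧) (s : ℕ) :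
    nested q k m (fun j => g j - h j) s = nested q k m g s - nested q k m h s := by
  induction k generalizing m s with
  | zero => rfl
  | succ k ih =>
    simp only [nested]
    rw [← step_sub]
    congr 1; funext j
    exact ih _ j

lemma nestedTop_sub (k : ℕ) (m : ℕ → ℤ) (g h : ℕ → K⟦X⟧) :
    nestedTop q k m (fun j => g j - h j) = nestedTop q k m g - nestedTop q k m h := by
  rw [nestedTop, nestedTop, nestedTop, ← step_sub]
  congr 1; funext j
  exact nested_sub _ _ _ _ j

lemma step_shift (hq0 : q ≠ 0) (e : ℕ → K) (μ : ℤ) {g h : ℕ → K⟦X⟧} {c : K⟦X⟧}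
    (h0 : g 0 = 0) (hs : ∀ s, g (s + 1) = c * h s) :
    step q e (μ + 2) g
      = X * C (q ^ (-1 - μ)) * c * step q (fun j => e (j + 1)) μ h := by
  rw [step, shiftSum_succ, h0, mul_zero, zero_add, step]
  simp only [← shiftSum_mul_left]
  refine congrArg shiftSum (funext fun j => ?_)
  have : q ^ (((j + 1 : ℕ) : ℤ) ^ 2 - (μ + 2) * (j + 1 : ℕ))
      = q ^ (-1 - μ) * q ^ ((j : ℤ) ^ 2 - μ * j) := by
    rw [← zpow_add₀ hq0]; congr 1; push_cast; ring
  rw [hs, this]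
  simp only [map_mul]; ring

lemma kernel_succ_succ (s j : ℕ) : kernel q (s + 1) (j + 1) = kernel q s j := by
  simp [kernel]

lemma nested_shift (hq0 : q ≠ 0) (k : ℕ) (m : ℕ → ℤ) {g h : ℕ → K⟦X⟧} {c : K⟦X⟧}
    (h0 : g 0 = 0) (hs : ∀ s, g (s + 1) = c * h s) :
    nested q k (fun t => m t + 2) g 0 = 0 ∧
    ∀ s, nested q k (fun t => m t + 2) g (s + 1)
      = X ^ k * C (q ^ (-k - ∑ t ∈ range k, m t)) * c * nested q k m h s := by
  induction k generalizing m with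
  | zero => simpa [nested] using ⟨h0, hs⟩
  | succ k ih =>
    obtain ⟨ih0, ihs⟩ := ih (fun t => m (t + 1))
    simp only [nested]
    refine ⟨?_, fun s => ?_⟩
    · rw [step_shift hq0 _ _ ih0 ihs]
      simp [step, kernel, shiftSum]
      exact Or.inr rfl
    · rw [step_shift hq0 _ _ ih0 ihs]
      simp only [kernel_succ_succ]
      rw [sum_range_succ', show (-((k + 1 : ℕ) : ℤ) - (∑ t ∈ range k, m (t + 1) + m 0))
        = (-1 - m 0) + (-k - ∑ t ∈ range k, m (t + 1)) by push_cast; ring, zpow_add₀ hq0, map_mul]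
      ring

lemma nestedTop_shift (hq0 : q ≠ 0) (k : ℕ) (m : ℕ → ℤ) {g h : ℕ → K⟦X⟧} {c : K⟦X⟧}
    (h0 : g 0 = 0) (hs : ∀ s, g (s + 1) = c * h s) :
    nestedTop q k (fun t => m t + 2) g
      = X ^ (k + 1) * C (q ^ (-(k + 1 : ℤ) - ∑ t ∈ range (k + 1), m t)) * c
          * nestedTop q k m h := by
  obtain ⟨ih0, ihs⟩ := nested_shift hq0 k (fun t => m (t + 1)) h0 hs
  rw [nestedTop, step_shift hq0 _ _ ih0 ihs, nestedTop, sum_range_succ',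
    show (-((k + 1 : ℤ)) - (∑ t ∈ range k, m (t + 1) + m 0))
        = (-1 - m 0) + (-k - ∑ t ∈ range k, m (t + 1)) by ring, zpow_add₀ hq0, map_mul]
  change X * _ * _ * step q 1 _ _ = _
  ring


lemma rescale_C (a b : K) : rescale a (C b : K⟦X⟧) = C b := by
  ext n; rw [coeff_rescale, coeff_C]; split_ifs with h <;> simp [h]

lemma one_sub_C_mul_X_ne_zero (a : K) : (1 - C a * X : K⟦X⟧) ≠ 0 := fun h => by
  simpa using congrArg constantCoeff h

lemma tail_zero : tail q 0 = 1 := by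
  simp [tail, qPoch]

lemma constantCoeff_prod_one_sub (s : ℕ) :
    constantCoeff (∏ i ∈ range s, (1 - C (q ^ (i + 1)) * X) : K⟦X⟧) ≠ 0 := by
  simp [map_prod]

lemma C_qPoch_mul_tail (hq : ∀ n : ℕ, q ^ (n + 1) ≠ 1) (s : ℕ) :
    C (qPoch q s) * (∏ i ∈ range s, (1 - C (q ^ (i + 1)) * X)) * tail q s = 1 := by
  have h1 : (C (qPoch q s) * C (qPoch q s)⁻¹ : K⟦X⟧) = 1 := by
    rw [← map_mul, mul_inv_cancel₀ (qPoch_ne_zero hq s), map_one]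
  have h2 := PowerSeries.mul_inv_cancel _ (constantCoeff_prod_one_sub (q := q) s)
  rw [tail]
  linear_combination h1 + C (qPoch q s) * C (qPoch q s)⁻¹ * h2

lemma prod_one_sub_ne_zero (s : ℕ) :
    (∏ i ∈ range s, (1 - C (q ^ (i + 1)) * X) : K⟦X⟧) ≠ 0 :=
  prod_ne_zero_iff.2 fun _ _ => one_sub_C_mul_X_ne_zero _

lemma C_qPoch_ne_zero (hq : ∀ n : ℕ, q ^ (n + 1) ≠ 1) (s : ℕ) : (C (qPoch q s) : K⟦X⟧) ≠ 0 :=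
  (map_ne_zero_iff _ PowerSeries.C_injective).2 (qPoch_ne_zero hq s)

lemma tail_succ (hq : ∀ n : ℕ, q ^ (n + 1) ≠ 1) (s : ℕ) :
    (1 - C (q ^ (s + 1))) * (1 - C (q ^ (s + 1)) * X) * tail q (s + 1) = tail q s := by
  have h1 := C_qPoch_mul_tail hq s
  have h2 := C_qPoch_mul_tail hq (s + 1)
  rw [prod_range_succ, qPoch_succ, map_mul, map_sub, map_one] at h2
  refine mul_left_cancel₀ (mul_ne_zero (C_qPoch_ne_zero hq s) (prod_one_sub_ne_zero (q := q) s)) ?_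
  linear_combination h2 - h1

lemma rescale_prod_one_sub (s : ℕ) :
    (1 - C q * X) * rescale q (∏ i ∈ range s, (1 - C (q ^ (i + 1)) * X))
      = (1 - C (q ^ (s + 1)) * X) * ∏ i ∈ range s, (1 - C (q ^ (i + 1)) * X) := by
  have : rescale q (∏ i ∈ range s, (1 - C (q ^ (i + 1)) * X))
      = ∏ i ∈ range s, (1 - C (q ^ (i + 1 + 1)) * X) := by
    rw [map_prod]
    refine prod_congr rfl fun i _ => ?_
    rw [map_sub, map_one, map_mul, rescale_C, rescale_X, ← mul_assoc, ← map_mul, ← pow_succ]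
  rw [this, mul_comm (1 - C (q ^ (s + 1)) * X), ← prod_range_succ, prod_range_succ', zero_add,
    pow_one, mul_comm]

lemma rescale_tail (hq : ∀ n : ℕ, q ^ (n + 1) ≠ 1) (s : ℕ) :
    (1 - C (q ^ (s + 1)) * X) * rescale q (tail q s) = (1 - C q * X) * tail q s := by
  have h1 := C_qPoch_mul_tail hq s
  have h2 := congrArg (rescale q) h1
  rw [map_mul, map_mul, map_one, rescale_C] at h2
  have h3 := rescale_prod_one_sub (q := q) s
  refine mul_left_cancel₀ (mul_ne_zero (C_qPoch_ne_zero hq s) (prod_one_sub_ne_zero (q := q) s)) ?_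
  linear_combination (1 - C q * X) * h2 - C (qPoch q s) * rescale q (tail q s) * h3
    - (1 - C q * X) * h1

/-- The factor relating `tail q s - tail q s (qX)` to `tail q (s - 1) (q²X)`. -/
noncomputable def ratio (q : K) : K⟦X⟧ :=
  C q * X * (1 - C q * X)⁻¹ * (1 - C (q ^ 2) * X)⁻¹

lemma ratio_mul : ratio q * ((1 - C q * X) * (1 - C (q ^ 2) * X)) = C q * X := by
  have h1 := PowerSeries.mul_inv_cancel (1 - C q * X) (by simp)
  have h2 := PowerSeries.mul_inv_cancel (1 - C (q ^ 2) * X) (by simp)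
  rw [ratio]
  linear_combination C q * X * h1 + C q * X * h2 * (1 - C q * X) * (1 - C q * X)⁻¹

lemma tail_sub_rescale (hq : ∀ n : ℕ, q ^ (n + 1) ≠ 1) (s : ℕ) :
    tail q (s + 1) - rescale q (tail q (s + 1))
      = ratio q * rescale q (rescale q (tail q s)) := by
  have h1 := rescale_tail hq (s + 1)
  have h2 := tail_succ hq s
  have h3 := rescale_tail hq s
  have h4 := congrArg (rescale q) h3
  simp only [map_mul, map_sub, map_one, rescale_C, rescale_X] at h4
  have h5 := ratio_mul (q := q)
  simp only [map_pow] at *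
  have n1 := one_sub_C_mul_X_ne_zero q
  have n2 := one_sub_C_mul_X_ne_zero (q ^ 2)
  have n3 := one_sub_C_mul_X_ne_zero (q ^ (s + 1))
  have n4 := one_sub_C_mul_X_ne_zero (q ^ (s + 2))
  simp only [map_pow] at n2 n3 n4
  refine mul_left_cancel₀ (mul_ne_zero (mul_ne_zero (mul_ne_zero n1 n2) n3) n4) ?_
  linear_combination
    (-(1 - C q * X) * (1 - C q ^ 2 * X) * (1 - C q ^ (s + 1) * X)) * h1
      + ((1 - C q * X) * (1 - C q ^ 2 * X) * C q * X) * h2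
      - (1 - C q ^ (s + 1) * X) * (1 - C q ^ (s + 2) * X) * rescale q (rescale q (tail q s)) * h5
      - C q * X * (1 - C q ^ (s + 1) * X) * h4 - C q * X * (1 - C q ^ 2 * X) * h3

lemma nestedTop_tail_add_one (hq0 : q ≠ 0) (hq : ∀ n : ℕ, q ^ (n + 1) ≠ 1) (k : ℕ) (m : ℕ → ℤ) :
    (1 - C q * X) * (1 - C (q ^ 2) * X)
        * (nestedTop q k m (tail q) - rescale q (nestedTop q k (fun t => m t + 1) (tail q)))
      = C (q ^ (k + 2 - ∑ t ∈ range (k + 1), m t)) * X ^ (k + 2)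
          * rescale q (rescale q (nestedTop q k m (tail q))) := by
  have e1 : rescale q (rescale q (nestedTop q k m (tail q)))
      = nestedTop q k (fun t => m t - 2) (fun j => rescale q (rescale q (tail q j))) := by
    rw [← rescale_nestedTop hq0, ← rescale_nestedTop hq0]
    simp only [sub_add, show (2 : ℤ) - 1 - 1 = 0 by norm_num, sub_zero]
  have e2 := nestedTop_shift hq0 k (fun t => m t - 2)
    (g := fun j => tail q j - rescale q (tail q j))
    (h := fun j => rescale q (rescale q (tail q j))) (c := ratio q)
    (by simp [tail_zero]) (tail_sub_rescale hq)
  simp only [sub_add_cancel] at e2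
  rw [rescale_nestedTop hq0, ← nestedTop_sub, e2, e1]
  have e3 : (-(k + 1 : ℤ) - ∑ t ∈ range (k + 1), (m t - 2))
      = (k + 2 - ∑ t ∈ range (k + 1), m t) - 1 := by
    rw [sum_sub_distrib]; simp; ring
  have e4 : (C (q ^ (k + 2 - ∑ t ∈ range (k + 1), m t)) : K⟦X⟧)
      = C (q ^ ((k + 2 - ∑ t ∈ range (k + 1), m t) - 1)) * C q := by
    rw [← map_mul, ← zpow_add_one₀ hq0, sub_add_cancel]
  rw [e3, e4]
  linear_combination X ^ (k + 1) * C (q ^ ((k + 2 - ∑ t ∈ range (k + 1), m t) - 1))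
    * nestedTop q k (fun t => m t - 2) (fun j => rescale q (rescale q (tail q j)))
    * ratio_mul (q := q)

/-- A power series satisfying the first-order `q`-difference equation below is determined by its
constant coefficient. -/
lemma eq_of_qDifference (hq : ∀ n : ℕ, q ^ (n + 1) ≠ 1) {c : K} {φ ψ : K⟦X⟧}
    (hφ : (1 - C q * X) * φ = (1 - C (c * q) * X) * rescale q φ)
    (hψ : (1 - C q * X) * ψ = (1 - C (c * q) * X) * rescale q ψ)
    (h0 : coeff 0 φ = coeff 0 ψ) : φ = ψ := by
  have key : ∀ {χ : K⟦X⟧}, (1 - C q * X) * χ = (1 - C (c * q) * X) * rescale q χ →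
      ∀ n, (1 - q ^ (n + 1)) * coeff (n + 1) χ = (q - c * q * q ^ n) * coeff n χ := by
    intro χ h n
    have := congrArg (coeff (n + 1)) h
    simp only [sub_mul, one_mul, mul_assoc, map_sub, coeff_C_mul, coeff_succ_X_mul,
      coeff_rescale] at this
    linear_combination this
  ext n
  induction n with
  | zero => exact h0
  | succ n ih =>
    refine mul_left_cancel₀ (sub_ne_zero.2 (hq n).symm) ?_
    rw [key hφ, key hψ, ih]

lemma euler_qDifference (hq : ∀ n : ℕ, q ^ (n + 1) ≠ 1) :
    (1 - C q * X) * euler q = rescale q (euler q) := by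
  ext n
  cases n with
  | zero => simp [sub_mul, mul_assoc]
  | succ n =>
    have h := qPoch_ne_zero hq n
    have h' := sub_ne_zero.2 (hq n).symm
    simp only [sub_mul, one_mul, mul_assoc, map_sub, coeff_C_mul, coeff_succ_X_mul,
      coeff_rescale, euler, coeff_mk, qPoch_succ]
    field_simp
    ring

lemma step_tail_qDifference (hq : ∀ n : ℕ, q ^ (n + 1) ≠ 1) {c : K} {e : ℕ → K}
    (he : ∀ j, q ^ j * e (j + 1) = (q ^ j - c) * e j) :
    (1 - C q * X) * step q e 0 (tail q)
      = (1 - C (c * q) * X) * rescale q (step q e 0 (tail q)) := by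
  set G : ℕ → K⟦X⟧ := fun j =>
    -(C (q ^ (j ^ 2) * e j * (1 - q ^ j)) * ((1 - C q * X) * tail q j)) with hG
  have hsucc : ∀ j, G (j + 1)
      = -(C (q ^ (j ^ 2) * q ^ (j + 1) * ((q ^ j - c) * e j)) * rescale q (tail q j)) := by
    intro j
    have h1 := tail_succ hq j
    have h2 := rescale_tail hq j
    refine mul_left_cancel₀ (one_sub_C_mul_X_ne_zero (q ^ (j + 1))) ?_
    have h3 : q ^ ((j + 1) ^ 2) * e (j + 1) = q ^ (j ^ 2) * q ^ (j + 1) * ((q ^ j - c) * e j) := by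
      rw [← he]; ring
    simp only [hG]
    rw [h3, map_mul C _ (1 - q ^ (j + 1)), map_sub C 1, map_one]
    linear_combination (-C (q ^ (j ^ 2) * q ^ (j + 1) * ((q ^ j - c) * e j))) *
      ((1 - C q * X) * h1 - h2)
  have hstep : step q e 0 (tail q) = shiftSum fun j => C (q ^ (j ^ 2) * e j) * tail q j := by
    simp only [step, zero_mul, sub_zero]
    norm_cast
  have hresc : rescale q (step q e 0 (tail q))
      = shiftSum fun j => C (q ^ (j ^ 2) * q ^ j * e j) * rescale q (tail q j) := by
    rw [hstep, rescale_shiftSum]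
    refine congrArg shiftSum (funext fun j => ?_)
    rw [map_mul (rescale q), rescale_C, ← mul_assoc, ← map_mul]
    congr 2; ring
  have hterm : ∀ j, (1 - C q * X) * (C (q ^ (j ^ 2) * e j) * tail q j)
      - (1 - C (c * q) * X) * (C (q ^ (j ^ 2) * q ^ j * e j) * rescale q (tail q j))
      = X * G (j + 1) - G j := by
    intro j
    have h2 := rescale_tail hq j
    rw [hsucc]
    simp only [hG]
    simp only [map_mul, map_sub, map_one, pow_succ q j] at h2 ⊢
    linear_combination (-C (q ^ j) * C (q ^ (j ^ 2)) * C (e j)) * h2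
  rw [← sub_eq_zero, hresc, hstep, ← shiftSum_mul_left, ← shiftSum_mul_left, ← shiftSum_sub]
  simp only [hterm]
  rw [shiftSum_sub, shiftSum_mul_left, shiftSum_succ G]
  simp [hG]

lemma coeff_zero_step_tail (e : ℕ → K) : coeff 0 (step q e 0 (tail q)) = e 0 := by
  simp [step, shiftSum, tail_zero]

lemma step_one_tail (hq : ∀ n : ℕ, q ^ (n + 1) ≠ 1) :
    step q 1 0 (tail q) = euler q := by
  refine eq_of_qDifference hq (c := 0) (step_tail_qDifference hq (by simp))
    (by simpa using euler_qDifference hq) ?_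
  rw [coeff_zero_step_tail]; simp [euler, qPoch]

lemma kernel_succ (hq : ∀ n : ℕ, q ^ (n + 1) ≠ 1) (s j : ℕ) :
    q ^ j * kernel q s (j + 1) = (q ^ j - q ^ s) * kernel q s j := by
  simp only [kernel]
  rcases lt_trichotomy j s with h | h | h
  · obtain ⟨d, rfl⟩ := Nat.exists_eq_add_of_lt h
    rw [if_pos (by omega), if_pos (by omega), show j + d + 1 - (j + 1) = d by omega,
      show j + d + 1 - j = d + 1 by omega, qPoch_succ]
    have h := qPoch_ne_zero hq d
    have h' := sub_ne_zero.2 (hq d).symm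
    field_simp
    ring
  · subst h; simp
  · rw [if_neg (by omega), if_neg (by omega)]; simp

lemma step_kernel_tail (hq : ∀ n : ℕ, q ^ (n + 1) ≠ 1) (s : ℕ) :
    step q (kernel q s) 0 (tail q) = tail q s := by
  refine eq_of_qDifference hq (c := q ^ s) (step_tail_qDifference hq (kernel_succ hq s))
    ?_ ?_
  · rw [← pow_succ, rescale_tail hq]
  · rw [coeff_zero_step_tail]
    simp [kernel, tail, map_prod]

lemma nested_congr {k : ℕ} {m m' : ℕ → ℤ} (h : ∀ t < k, m t = m' t) (g : ℕ → K⟦X⟧) :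
    nested q k m g = nested q k m' g := by
  induction k generalizing m m' with
  | zero => rfl
  | succ k ih =>
    funext s
    simp only [nested]
    rw [h 0 k.succ_pos, ih fun t ht => h (t + 1) (Nat.succ_lt_succ ht)]

lemma nestedTop_congr {k : ℕ} {m m' : ℕ → ℤ} (h : ∀ t ≤ k, m t = m' t) (g : ℕ → K⟦X⟧) :
    nestedTop q k m g = nestedTop q k m' g := by
  rw [nestedTop, nestedTop, h 0 k.zero_le, nested_congr fun t ht => h (t + 1) ht]

lemma nested_succ_tail (hq : ∀ n : ℕ, q ^ (n + 1) ≠ 1) {k : ℕ} {m : ℕ → ℤ}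
    (h : m k = 0) : nested q (k + 1) m (tail q) = nested q k m (tail q) := by
  induction k generalizing m with
  | zero =>
    funext s
    simp only [nested]
    rw [h, step_kernel_tail hq]
  | succ k ih =>
    funext s
    rw [nested, ih (m := fun t => m (t + 1)) h, nested]

lemma nestedTop_succ_tail (hq : ∀ n : ℕ, q ^ (n + 1) ≠ 1) {k : ℕ} {m : ℕ → ℤ}
    (h : m (k + 1) = 0) : nestedTop q (k + 1) m (tail q) = nestedTop q k m (tail q) := by
  rw [nestedTop, nested_succ_tail hq (m := fun t => m (t + 1)) h, nestedTop]

/-- Coefficients of a power series, extended by zero to negative degrees. -/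
noncomputable def zcoeff (φ : K⟦X⟧) (n : ℤ) : K := if 0 ≤ n then coeff n.toNat φ else 0

lemma zcoeff_natCast (φ : K⟦X⟧) (n : ℕ) : zcoeff φ n = coeff n φ := by simp [zcoeff]

lemma zcoeff_of_neg (φ : K⟦X⟧) {n : ℤ} (h : n < 0) : zcoeff φ n = 0 := if_neg (by omega)

lemma zcoeff_sub (φ ψ : K⟦X⟧) (n : ℤ) : zcoeff (φ - ψ) n = zcoeff φ n - zcoeff ψ n := by
  simp only [zcoeff]; split_ifs <;> simp

lemma zcoeff_C_mul (a : K) (φ : K⟦X⟧) (n : ℤ) : zcoeff (C a * φ) n = a * zcoeff φ n := by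
  simp only [zcoeff]; split_ifs <;> simp

lemma zcoeff_X_pow_mul (k : ℕ) (φ : K⟦X⟧) (n : ℤ) :
    zcoeff (X ^ k * φ) n = zcoeff φ (n - k) := by
  simp only [zcoeff, coeff_X_pow_mul']
  split_ifs <;> first | rfl | (exfalso; omega) | skip
  congr 2; omega

lemma zcoeff_rescale (a : K) (φ : K⟦X⟧) (n : ℤ) :
    zcoeff (rescale a φ) n = a ^ n * zcoeff φ n := by
  simp only [zcoeff, coeff_rescale]
  split_ifs with h
  · rw [← zpow_natCast, Int.toNat_of_nonneg h]
  · simp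

/-- `φ` is a polynomial of degree at most `D`, invariant under reversal of its coefficients. -/
def Palindromic (D : ℤ) (φ : K⟦X⟧) : Prop := ∀ n, zcoeff φ (D - n) = zcoeff φ n

lemma Palindromic.of_recursion [CharZero K] (hq0 : q ≠ 0) {D : ℤ} {k : ℕ} {φ ψ : K⟦X⟧}
    (hφ : Palindromic D φ)
    (h : φ - (1 - C q * X) * rescale q ψ
      = C (q ^ (k - D)) * X ^ k * rescale q (rescale q φ)) :
    Palindromic (D + k - 1) ψ := by
  have rec1 : ∀ n : ℤ, zcoeff ψ n - zcoeff ψ (n - 1)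
      = q ^ (-n) * zcoeff φ n - q ^ (n - k - D) * zcoeff φ (n - k) := by
    intro n
    have h1 := congrArg (zcoeff · n) h
    simp only [sub_mul, one_mul, mul_assoc] at h1
    rw [← pow_one (X : K⟦X⟧)] at h1
    simp only [zcoeff_sub, zcoeff_C_mul, zcoeff_X_pow_mul, zcoeff_rescale] at h1
    rw [← pow_mul, one_mul] at h1
    simp only [zcoeff_X_pow_mul, zcoeff_rescale, Nat.cast_one] at h1
    have e1 : q ^ n = q * q ^ (n - 1) := by
      rw [← zpow_one_add₀ hq0]; congr 1; ring
    have e2 : q ^ (-n) * q ^ n = 1 := by rw [← zpow_add₀ hq0]; simp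
    have e3 : q ^ (n - k - D) = q ^ (-n) * (q ^ (k - D) * (q ^ (n - k) * q ^ (n - k))) := by
      simp only [← zpow_add₀ hq0]; congr 1; ring
    rw [e3]
    linear_combination (-q ^ (-n)) * h1 - (zcoeff ψ n - zcoeff ψ (n - 1)) * e2
      - q ^ (-n) * zcoeff ψ (n - 1) * e1
  set f : ℤ → K := fun n => zcoeff ψ n - zcoeff ψ (D + k - 1 - n) with hf
  have hconst : ∀ n, f n = f (n - 1) := by
    intro n
    have h1 := rec1 n
    have h2 := rec1 (D + k - n)
    have h3 := hφ n
    have h4 := hφ (n - k)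
    rw [show D - (n - k) = D + k - n by ring] at h4
    rw [show D + k - n - k - D = -n by ring, show D + k - n - k = D - n by ring, h4, h3,
      show -(D + k - n) = n - k - D by ring] at h2
    simp only [hf]
    rw [show D + k - 1 - n = D + k - n - 1 by ring,
      show D + k - 1 - (n - 1) = D + k - n by ring]
    linear_combination h1 + h2
  have hconst' : ∀ n, f n = f 0 := by
    intro n
    induction n with
    | zero => rfl
    | succ i ih => rw [hconst, add_sub_cancel_right, ih]
    | pred i ih => rw [← hconst, ih]
  intro n
  have h1 := (hconst' n).trans (hconst' (D + k - 1 - n)).symm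
  simp only [hf, sub_sub_cancel] at h1
  have h2 : (2 : K) * (zcoeff ψ (D + k - 1 - n) - zcoeff ψ n) = 0 := by linear_combination -h1
  exact sub_eq_zero.1 ((mul_eq_zero.1 h2).resolve_left two_ne_zero)

lemma euler_mul_inv : euler q * (euler q)⁻¹ = 1 :=
  PowerSeries.mul_inv_cancel _ (by simp [euler, qPoch, ← coeff_zero_eq_constantCoeff_apply])

lemma euler_ne_zero : euler q ≠ 0 := left_ne_zero_of_mul_eq_one euler_mul_inv

lemma Palindromic.of_nestedTop_add_one [CharZero K] (hq0 : q ≠ 0)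
    (hq : ∀ n : ℕ, q ^ (n + 1) ≠ 1) {k : ℕ} {m : ℕ → ℤ}
    (h : Palindromic (∑ t ∈ range (k + 1), m t) (nestedTop q k m (tail q) * (euler q)⁻¹)) :
    Palindromic (∑ t ∈ range (k + 1), (m t + 1))
      (nestedTop q k (fun t => m t + 1) (tail q) * (euler q)⁻¹) := by
  have hdeg : ∑ t ∈ range (k + 1), (m t + 1) = ∑ t ∈ range (k + 1), m t + (k + 2 : ℕ) - 1 := by
    rw [sum_add_distrib]; simp; ring
  rw [hdeg]
  refine h.of_recursion hq0 ?_
  have e1 := nestedTop_tail_add_one hq0 hq k m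
  have e2 := euler_mul_inv (q := q)
  have e3 := euler_qDifference hq
  have e4 := congrArg (rescale q) e3
  have e5 := congrArg (rescale q) e2
  have e6 := congrArg (rescale q) e5
  simp only [map_mul, map_sub, map_one, rescale_C, rescale_X] at e4 e5 e6 ⊢
  push_cast
  generalize nestedTop q k m (tail q) = A at *
  generalize nestedTop q k (fun t => m t + 1) (tail q) = B at *
  generalize C (q ^ ((k : ℤ) + 2 - ∑ t ∈ range (k + 1), m t)) = c at *
  simp only [map_pow] at e1
  generalize (euler q)⁻¹ = N at *
  have n1 := one_sub_C_mul_X_ne_zero q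
  have n2 := one_sub_C_mul_X_ne_zero (q ^ 2)
  rw [map_pow] at n2
  refine mul_left_cancel₀ (mul_ne_zero (mul_ne_zero n1 n2) (euler_ne_zero (q := q))) ?_
  have f1 : (1 - C q * X) * euler q * rescale q N = 1 := by rw [e3, e5]
  have f2 : (1 - C q ^ 2 * X) * (1 - C q * X) * euler q * rescale q (rescale q N) = 1 := by
    linear_combination (1 - C q ^ 2 * X) * rescale q (rescale q N) * e3
      + rescale q (rescale q N) * e4 + e6
  linear_combination e1 + (1 - C q * X) * (1 - C q ^ 2 * X) * A * e2
    - (1 - C q * X) * (1 - C q ^ 2 * X) * rescale q B * f1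
    - c * X ^ (k + 2) * rescale q (rescale q A) * f2

lemma palindromic_one : Palindromic 0 (1 : K⟦X⟧) := fun n => by
  rcases lt_trichotomy n 0 with h | h | h
  · obtain ⟨j, rfl⟩ := Int.exists_eq_neg_ofNat h.le
    rw [zcoeff_of_neg _ h, zero_sub, neg_neg, zcoeff_natCast, coeff_one, if_neg (by omega)]
  · rw [h, sub_zero]
  · obtain ⟨j, rfl⟩ := Int.eq_ofNat_of_zero_le h.le
    rw [zcoeff_of_neg _ (by omega), zcoeff_natCast, coeff_one, if_neg (by omega)]

/-- Divided by Euler's series, a nested sum with antitone weights `m` is a palindromic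
polynomial of degree `∑ m`. -/
theorem palindromic_nestedTop [CharZero K] (hq0 : q ≠ 0) (hq : ∀ n : ℕ, q ^ (n + 1) ≠ 1) (k : ℕ)
    {m : ℕ → ℕ} (hm : Antitone m) :
    Palindromic (∑ t ∈ range (k + 1), (m t : ℤ))
      (nestedTop q k (fun t => m t) (tail q) * (euler q)⁻¹) := by
  induction k generalizing m with
  | zero =>
    generalize hd : m 0 = d
    induction d generalizing m with
    | zero =>
      have : nestedTop q 0 (fun t => (m t : ℤ)) (tail q) = euler q := by
        simp only [nestedTop, nested, hd, Nat.cast_zero, step_one_tail hq]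
      rw [this, euler_mul_inv]
      simpa [hd] using palindromic_one
    | succ d ihd =>
      have h1 := (ihd (m := fun t => m t - 1) (fun a b h => Nat.sub_le_sub_right (hm h) 1)
        (by simp [hd])).of_nestedTop_add_one hq0 hq
      convert h1 using 1
      · simp [hd]
      · rw [nestedTop_congr fun t ht => ?_]
        obtain rfl : t = 0 := by omega
        simp [hd]
  | succ k ih =>
    generalize hd : m (k + 1) = d
    induction d generalizing m with
    | zero =>
      rw [nestedTop_succ_tail hq (by simp [hd]), sum_range_succ, hd, Nat.cast_zero, add_zero]
      exact ih hm
    | succ d ihd =>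
      have hpos : ∀ t ≤ k + 1, ((m t - 1 : ℕ) : ℤ) + 1 = m t := fun t ht => by
        have := hm ht
        omega
      have h1 := (ihd (m := fun t => m t - 1) (fun a b h => Nat.sub_le_sub_right (hm h) 1)
        (by simp [hd])).of_nestedTop_add_one hq0 hq
      convert h1 using 1
      · exact sum_congr rfl fun t ht => (hpos t (by simpa [Nat.lt_succ_iff] using ht)).symm
      · rw [nestedTop_congr fun t ht => (hpos t ht).symm]

end QSeries

section Descending

/-- Prepend a value to a sequence. -/
def consSeq (j : ℕ) (r : ℕ → ℕ) : ℕ → ℕ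
  | 0 => j
  | t + 1 => r t

open Classical in
/-- The descending sequences bounded by `s` that vanish from index `k` on. -/
noncomputable def descBox : ℕ → ℕ → Finset (ℕ → ℕ)
  | 0, _ => {0}
  | k + 1, s => (range (s + 1)).biUnion fun j => (descBox k j).map
      ⟨consSeq j, fun _ _ h => funext fun t => congrFun h (t + 1)⟩

lemma mem_descBox {k s : ℕ} {r : ℕ → ℕ} :
    r ∈ descBox k s ↔ Antitone r ∧ r 0 ≤ s ∧ ∀ t, k ≤ t → r t = 0 := by
  induction k generalizing s r with
  | zero =>
    simp only [descBox, mem_singleton]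
    refine ⟨?_, fun h => funext fun t => h.2.2 t t.zero_le⟩
    rintro rfl
    exact ⟨antitone_const, s.zero_le, fun _ _ => rfl⟩
  | succ k ih =>
    simp only [descBox, mem_biUnion, mem_range, mem_map, ih]
    constructor
    · rintro ⟨j, hj, r, ⟨h1, h2, h3⟩, rfl⟩
      refine ⟨antitone_nat_of_succ_le ?_, Nat.lt_succ_iff.1 hj, ?_⟩
      · rintro (_ | t)
        · exact h2
        · exact h1 t.le_succ
      · rintro (_ | t) ht
        · omega
        · exact h3 t (by omega)
    · rintro ⟨h1, h2, h3⟩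
      refine ⟨r 0, Nat.lt_succ_iff.2 h2, fun t => r (t + 1), ⟨?_, h1 zero_le_one, ?_⟩, ?_⟩
      · exact fun a b h => h1 (Nat.succ_le_succ h)
      · exact fun t ht => h3 _ (by omega)
      · funext t; cases t <;> rfl

lemma sum_descBox_succ {M : Type*} [AddCommMonoid M] (k s : ℕ) (f : (ℕ → ℕ) → M) :
    ∑ r ∈ descBox (k + 1) s, f r
      = ∑ j ∈ range (s + 1), ∑ r ∈ descBox k j, f (consSeq j r) := by
  classical
  rw [descBox, sum_biUnion]
  · simp only [sum_map]
    rfl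
  · intro j _ j' _ hne
    refine disjoint_left.2 fun r h h' => hne ?_
    simp only [mem_map] at h h'
    obtain ⟨_, _, rfl⟩ := h
    obtain ⟨_, _, h⟩ := h'
    exact (congrFun h 0).symm

/-- The descending sequences of total size `n`. -/
noncomputable def descOfSize (n : ℕ) : Finset (ℕ → ℕ) := {r ∈ descBox n n | ∑ t ∈ range n, r t = n}

lemma le_sum_of_antitone {r : ℕ → ℕ} (hr : Antitone r) {t N : ℕ} (ht : r t ≠ 0) (htN : t < N) :
    t + 1 ≤ ∑ i ∈ range N, r i := by
  calc t + 1 = ∑ i ∈ range (t + 1), 1 := by simp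
    _ ≤ ∑ i ∈ range (t + 1), r i := sum_le_sum fun i hi =>
        (Nat.one_le_iff_ne_zero.2 ht).trans (hr (Nat.lt_succ_iff.1 (mem_range.1 hi)))
    _ ≤ _ := sum_le_sum_of_subset (range_mono htN)

lemma filter_descBox_eq {k s n : ℕ} (hk : n ≤ k) (hs : n ≤ s) :
    {r ∈ descBox k s | ∑ t ∈ range k, r t = n} = descOfSize n := by
  ext r
  simp only [descOfSize, mem_filter, mem_descBox]
  constructor
  · rintro ⟨⟨h1, h2, h3⟩, h4⟩
    have h5 : ∀ t, n ≤ t → r t = 0 := by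
      intro t ht
      by_contra h
      have hlt : t < k := not_le.1 fun hk => h (h3 t hk)
      have := le_sum_of_antitone h1 h hlt
      omega
    have h6 : ∑ t ∈ range n, r t = n := by
      refine Eq.trans ?_ h4
      exact sum_subset (range_mono hk) fun t _ ht => h5 t (by simpa using ht)
    refine ⟨⟨h1, ?_, h5⟩, h6⟩
    rcases Nat.eq_zero_or_pos n with rfl | hn
    · rw [h5 0 le_rfl]
    · calc r 0 ≤ ∑ t ∈ range n, r t := single_le_sum (f := r) (by simp) (by simpa using hn)
        _ = n := h6
  · rintro ⟨⟨h1, h2, h3⟩, h4⟩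
    refine ⟨⟨h1, h2.trans hs, fun t ht => h3 t (hk.trans ht)⟩, ?_⟩
    rw [← h4]
    exact (sum_subset (range_mono hk) fun t _ ht => h3 t (by simpa using ht)).symm

lemma finsum_eq_sum_range {M : Type*} [AddCommMonoid M] {f : ℕ → M} {N : ℕ}
    (h : ∀ t, N ≤ t → f t = 0) : ∑ᶠ t, f t = ∑ t ∈ range N, f t :=
  finsum_eq_sum_of_support_subset _ fun t ht => by
    simpa using not_le.1 fun hN => ht (h t hN)

lemma finprod_eq_prod_range {M : Type*} [CommMonoid M] {f : ℕ → M} {N : ℕ}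
    (h : ∀ t, N ≤ t → f t = 1) : ∏ᶠ t, f t = ∏ t ∈ range N, f t :=
  finprod_eq_prod_of_mulSupport_subset _ fun t ht => by
    simpa using not_le.1 fun hN => ht (h t hN)

lemma mem_descOfSize {n : ℕ} {r : ℕ → ℕ} :
    r ∈ descOfSize n ↔ IsDescending r ∧ ∑ᶠ t, r t = n := by
  constructor
  · intro h
    simp only [descOfSize, mem_filter, mem_descBox] at h
    obtain ⟨⟨h1, -, h3⟩, h4⟩ := h
    exact ⟨⟨h1, n, h3⟩, (finsum_eq_sum_range h3).trans h4⟩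
  · rintro ⟨⟨h1, N, h2⟩, h3⟩
    have h4 : ∀ t, max N n ≤ t → r t = 0 := fun t ht => h2 t (le_of_max_le_left ht)
    rw [← filter_descBox_eq (le_max_right N n) (le_max_right (r 0) n), mem_filter, mem_descBox,
      ← finsum_eq_sum_range h4]
    exact ⟨⟨h1, le_max_left _ _, h4⟩, h3⟩

lemma eq_zero_of_mem_descOfSize {n : ℕ} {r : ℕ → ℕ} (h : r ∈ descOfSize n) {t : ℕ}
    (ht : n ≤ t) : r t = 0 := by
  simp only [descOfSize, mem_filter, mem_descBox] at h
  exact h.1.2.2 t ht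

lemma antitone_of_mem_descOfSize {n : ℕ} {r : ℕ → ℕ} (h : r ∈ descOfSize n) : Antitone r :=
  (mem_descOfSize.1 h).1.1

end Descending

section Unroll

variable {K : Type*} [Field K] (q : K)

/-- The weight `q ^ (∑ r² - m r) / ∏ (q;q)_{r_t - r_{t+1}}`, over the indices `t < k`. -/
noncomputable def seqWeight (k : ℕ) (m : ℕ → ℤ) (r : ℕ → ℕ) : K :=
  q ^ (∑ t ∈ range k, ((r t : ℤ) ^ 2 - m t * r t))
    * ∏ t ∈ range k, (qPoch q (r t - r (t + 1)))⁻¹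

variable {q}

lemma seqWeight_succ (hq0 : q ≠ 0) (k : ℕ) (m : ℕ → ℤ) (j : ℕ) (r : ℕ → ℕ) :
    seqWeight q (k + 1) m (consSeq j r) = q ^ ((j : ℤ) ^ 2 - m 0 * j)
      * ((qPoch q (j - r 0))⁻¹ * seqWeight q k (fun t => m (t + 1)) r) := by
  simp only [seqWeight, sum_range_succ', prod_range_succ', zpow_add₀ hq0, consSeq]
  ring

lemma sum_range_consSeq (k j : ℕ) (r : ℕ → ℕ) :
    ∑ t ∈ range (k + 1), consSeq j r t = j + ∑ t ∈ range k, r t := by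
  rw [sum_range_succ', add_comm]; rfl

lemma shiftSum_eq_sum {g : ℕ → K⟦X⟧} {s : ℕ} (h : ∀ j, s < j → g j = 0) :
    shiftSum g = ∑ j ∈ range (s + 1), X ^ j * g j := by
  ext n
  rw [coeff_shiftSum g (show n < max n s + 1 by omega), map_sum]
  refine (sum_subset (range_mono (by omega)) fun j _ hj => ?_).symm
  rw [h j (by simpa using hj), mul_zero, map_zero]

lemma nested_eq_sum (hq0 : q ≠ 0) (k : ℕ) (m : ℕ → ℤ) (s : ℕ) :
    nested q k m (fun s => C (qPoch q s)⁻¹) s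
      = ∑ r ∈ descBox k s, C ((qPoch q (s - r 0))⁻¹ * seqWeight q k m r)
          * X ^ ∑ t ∈ range k, r t := by
  induction k generalizing m s with
  | zero => simp [nested, descBox, seqWeight]
  | succ k ih =>
    simp only [nested, step]
    rw [ shiftSum_eq_sum (s := s), sum_descBox_succ]
    · refine sum_congr rfl fun j hj => ?_
      rw [ih, mul_sum, mul_sum]
      refine sum_congr rfl fun r _ => ?_
      have hj' : j ≤ s := Nat.lt_succ_iff.1 (mem_range.1 hj)
      rw [seqWeight_succ hq0, sum_range_consSeq, kernel, if_pos hj']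
      change _ = C ((qPoch q (s - j))⁻¹ * _) * _
      simp only [map_mul, pow_add]
      ring
    · intro j hj
      simp [kernel, not_le.2 hj]

lemma coeff_nestedTop (hq0 : q ≠ 0) {k n : ℕ} (hk : n ≤ k + 1) (m : ℕ → ℤ) :
    coeff n (nestedTop q k m (fun s => C (qPoch q s)⁻¹))
      = ∑ r ∈ descOfSize n, seqWeight q (k + 1) m r := by
  rw [nestedTop, step, coeff_shiftSum _ n.lt_succ_self,
    ← filter_descBox_eq hk (le_refl n), sum_filter, sum_descBox_succ]
  refine sum_congr rfl fun j _ => ?_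
  rw [nested_eq_sum hq0, mul_sum, mul_sum, map_sum]
  refine sum_congr rfl fun r _ => ?_
  rw [seqWeight_succ hq0, sum_range_consSeq]
  have : (X ^ j * (C (q ^ ((j : ℤ) ^ 2 - m 0 * j) * (1 : ℕ → K) j)
      * (C ((qPoch q (j - r 0))⁻¹ * seqWeight q k (fun t => m (t + 1)) r)
        * X ^ ∑ t ∈ range k, r t)) : K⟦X⟧)
      = C (q ^ ((j : ℤ) ^ 2 - m 0 * j)
          * ((qPoch q (j - r 0))⁻¹ * seqWeight q k (fun t => m (t + 1)) r))
        * X ^ (j + ∑ t ∈ range k, r t) := by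
    simp only [map_mul, pow_add, Pi.one_apply, map_one]; ring
  rw [this, coeff_C_mul, coeff_X_pow]
  simp [eq_comm]

lemma nested_of_zero {g : ℕ → K⟦X⟧} (h0 : g 0 = 0) (k : ℕ) (m : ℕ → ℤ) :
    nested q k m g 0 = 0 ∧ ∀ s, X ^ k ∣ nested q k m g s := by
  induction k generalizing m with
  | zero => simpa [nested] using h0
  | succ k ih =>
    obtain ⟨ih0, ihs⟩ := ih (fun t => m (t + 1))
    refine ⟨?_, fun s => ?_⟩
    · simp only [nested, step]
      rw [ shiftSum_eq_sum (s := 0)]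
      · simp [ih0]
      · intro j hj
        simp [kernel, not_le.2 hj]
    · choose c hc using ihs
      simp only [nested, step]
      rw [ shiftSum_succ, ih0, mul_zero, zero_add, pow_succ']
      refine mul_dvd_mul_left _ ?_
      simp only [hc, mul_left_comm _ (X ^ k)]
      rw [shiftSum_mul_left]
      exact dvd_mul_right _ _

lemma X_pow_dvd_nestedTop {g : ℕ → K⟦X⟧} (h0 : g 0 = 0) (k : ℕ) (m : ℕ → ℤ) :
    X ^ (k + 1) ∣ nestedTop q k m g := by
  obtain ⟨ih0, ihs⟩ := nested_of_zero (q := q) h0 k (fun t => m (t + 1))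
  choose c hc using ihs
  rw [nestedTop, step, shiftSum_succ, ih0, mul_zero, zero_add, pow_succ']
  refine mul_dvd_mul_left _ ?_
  simp only [hc, mul_left_comm _ (X ^ k)]
  rw [shiftSum_mul_left]
  exact dvd_mul_right _ _

variable (q) in
/-- The generating series `∑ q ^ (∑ r² - m r) X ^ |r| / ∏ (q;q)_{r_t - r_{t+1}}` over all
descending sequences. -/
noncomputable def descSeries (m : ℕ → ℤ) : K⟦X⟧ :=
  PowerSeries.mk fun n => ∑ r ∈ descOfSize n, seqWeight q n m r

lemma seqWeight_eq_of_le {n k : ℕ} (hk : n ≤ k) (m : ℕ → ℤ) {r : ℕ → ℕ}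
    (hr : r ∈ descOfSize n) : seqWeight q k m r = seqWeight q n m r := by
  have h := fun t (ht : n ≤ t) => eq_zero_of_mem_descOfSize hr ht
  rw [seqWeight, seqWeight]
  congr 1
  · congr 1
    exact (sum_subset (range_mono hk) fun t _ ht => by simp [h t (by simpa using ht)]).symm
  · exact (prod_subset (range_mono hk) fun t _ ht => by
      simp [h t (by simpa using ht), qPoch]).symm

lemma nestedTop_tail_eq (hq : ∀ n : ℕ, q ^ (n + 1) ≠ 1) {T : ℕ} {m : ℕ → ℤ}
    (hm : ∀ t, T ≤ t → m t = 0) {k : ℕ} (hk : T ≤ k) :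
    nestedTop q k m (tail q) = nestedTop q T m (tail q) := by
  induction k, hk using Nat.le_induction with
  | base => rfl
  | succ k hk ih => rw [nestedTop_succ_tail hq (hm _ (by omega)), ih]

lemma descSeries_eq_nestedTop (hq0 : q ≠ 0) (hq : ∀ n : ℕ, q ^ (n + 1) ≠ 1) {T : ℕ} {m : ℕ → ℤ}
    (hm : ∀ t, T ≤ t → m t = 0) : descSeries q m = nestedTop q T m (tail q) := by
  ext n
  set k := max n T
  have hn : n ≤ k := le_max_left _ _
  have h : X ^ (k + 1) ∣ nestedTop q k m (fun s => tail q s - C (qPoch q s)⁻¹) :=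
    X_pow_dvd_nestedTop (by simp [tail_zero, qPoch]) k m
  rw [nestedTop_sub, X_pow_dvd_iff] at h
  have h1 := h n (by omega)
  rw [map_sub, sub_eq_zero] at h1
  rw [← nestedTop_tail_eq hq hm (le_max_right n T), h1, coeff_nestedTop hq0 (by omega),
    descSeries, coeff_mk]
  exact sum_congr rfl fun r hr => (seqWeight_eq_of_le (by omega) m hr).symm

/-- Divided by Euler's series, the generating series of descending sequences with antitone
weights `m` is a palindromic polynomial of degree `∑ m`. -/
theorem palindromic_descSeries [CharZero K] (hq0 : q ≠ 0) (hq : ∀ n : ℕ, q ^ (n + 1) ≠ 1)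
    {m : ℕ → ℕ} (hm : Antitone m) {T : ℕ} (hT : ∀ t, T ≤ t → m t = 0) :
    Palindromic (∑ t ∈ range T, (m t : ℤ)) (descSeries q (fun t => m t) * (euler q)⁻¹) := by
  have h := palindromic_nestedTop hq0 hq T hm
  rw [sum_range_succ, hT T le_rfl, Nat.cast_zero, add_zero] at h
  rwa [descSeries_eq_nestedTop hq0 hq (T := T) fun t ht => by simp [hT t ht]]

end Unroll

section Lattice

variable {K : Type*} [CommRing K]

/-- An exponent, viewed as a vector of the lattice `ℤ²`. -/
def vec (d : Fin 2 →₀ ℕ) : ℤ × ℤ := (d 0, d 1)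

/-- The exponent with the given coordinates. -/
noncomputable def expo (a b : ℕ) : Fin 2 →₀ ℕ := Finsupp.equivFunOnFinite.symm ![a, b]

@[simp] lemma expo_zero (a b : ℕ) : expo a b 0 = a := rfl

@[simp] lemma expo_one (a b : ℕ) : expo a b 1 = b := rfl

lemma expo_apply (d : Fin 2 →₀ ℕ) : expo (d 0) (d 1) = d := by
  ext i; fin_cases i <;> rfl

lemma vec_injective : Function.Injective vec := fun d d' h => by
  simp only [vec, Prod.mk.injEq, Nat.cast_inj] at h
  rw [← expo_apply d, ← expo_apply d', h.1, h.2]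

lemma vec_add (d d' : Fin 2 →₀ ℕ) : vec (d + d') = vec d + vec d' := by simp [vec]

lemma vec_nsmul (k : ℕ) (d : Fin 2 →₀ ℕ) : vec (k • d) = k • vec d := by simp [vec]

lemma exists_vec_eq {v : ℤ × ℤ} (h : 0 ≤ v) : ∃ d, vec d = v := by
  refine ⟨expo v.1.toNat v.2.toNat, ?_⟩
  simpa [vec, Prod.ext_iff] using ⟨h.1, h.2⟩

lemma vec_nonneg (d : Fin 2 →₀ ℕ) : 0 ≤ vec d := by simp [vec, Prod.le_def]

open Classical in
/-- The coefficients of a bivariate power series, extended by zero to `ℤ²`. -/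
noncomputable def lcoeff (F : MvPowerSeries (Fin 2) K) (v : ℤ × ℤ) : K :=
  if 0 ≤ v then MvPowerSeries.coeff (expo v.1.toNat v.2.toNat) F else 0

lemma lcoeff_vec (F : MvPowerSeries (Fin 2) K) (d : Fin 2 →₀ ℕ) :
    lcoeff F (vec d) = MvPowerSeries.coeff d F := by
  rw [lcoeff, if_pos (vec_nonneg d)]
  simp [vec, expo_apply]

lemma lcoeff_of_not_nonneg (F : MvPowerSeries (Fin 2) K) {v : ℤ × ℤ} (h : ¬ 0 ≤ v) :
    lcoeff F v = 0 := if_neg h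

lemma lcoeff_mul (F G : MvPowerSeries (Fin 2) K) (v : ℤ × ℤ) :
    lcoeff (F * G) v = ∑ᶠ u, lcoeff F u * lcoeff G (v - u) := by
  classical
  by_cases hv : 0 ≤ v
  · obtain ⟨d, rfl⟩ := exists_vec_eq hv
    have hinj : Set.InjOn (fun p : (Fin 2 →₀ ℕ) × (Fin 2 →₀ ℕ) => vec p.1)
        (antidiagonal d : Finset ((Fin 2 →₀ ℕ) × (Fin 2 →₀ ℕ))) := by
      intro p hp p' hp' h
      have h1 := HasAntidiagonal.mem_antidiagonal.1 (mem_coe.1 hp)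
      have h2 := HasAntidiagonal.mem_antidiagonal.1 (mem_coe.1 hp')
      have h3 := vec_injective h
      refine Prod.ext h3 (add_left_cancel (a := p.1) ?_)
      rw [h1, h3, h2]
    rw [lcoeff_vec, MvPowerSeries.coeff_mul, finsum_eq_sum_of_support_subset
      (s := (antidiagonal d).image fun p => vec p.1), sum_image hinj]
    · refine sum_congr rfl fun p hp => ?_
      rw [← HasAntidiagonal.mem_antidiagonal.1 hp, vec_add, add_sub_cancel_left, lcoeff_vec,
        lcoeff_vec]
    · intro u hu
      have h1 : 0 ≤ u := by
        by_contra h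
        exact hu (by simp only [lcoeff_of_not_nonneg F h, zero_mul])
      have h2 : 0 ≤ vec d - u := by
        by_contra h
        exact hu (by simp only [lcoeff_of_not_nonneg G h, mul_zero])
      obtain ⟨e, rfl⟩ := exists_vec_eq h1
      obtain ⟨e', h3⟩ := exists_vec_eq h2
      rw [eq_sub_iff_add_eq', ← vec_add] at h3
      simp only [coe_image, Set.mem_image, SetLike.mem_coe]
      exact ⟨(e, e'), HasAntidiagonal.mem_antidiagonal.2 (vec_injective h3), rfl⟩
  · rw [lcoeff_of_not_nonneg _ hv, finsum_eq_zero_of_forall_eq_zero]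
    intro u
    by_cases h1 : 0 ≤ u
    · rw [lcoeff_of_not_nonneg G fun h2 => hv (h1.trans (sub_nonneg.1 h2)), mul_zero]
    · rw [lcoeff_of_not_nonneg F h1, zero_mul]

/-- The coefficients of `G` are those of `F`, moved by `s`. -/
def Moves (s : ℤ × ℤ ≃+ ℤ × ℤ) (F G : MvPowerSeries (Fin 2) K) : Prop :=
  ∀ v, lcoeff G (s v) = lcoeff F v

lemma Moves.mul {s : ℤ × ℤ ≃+ ℤ × ℤ} {F F' G G' : MvPowerSeries (Fin 2) K}
    (h : Moves s F G) (h' : Moves s F' G') : Moves s (F * F') (G * G') := fun v => by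
  rw [lcoeff_mul, lcoeff_mul, ← finsum_comp_equiv s.toEquiv]
  refine finsum_congr fun u => ?_
  have := h' (v - u)
  rw [map_sub] at this
  simp only [AddEquiv.toEquiv_eq_coe, EquivLike.coe_coe]
  rw [h u, this]

/-- The substitution `X ↦ y ^ c`. -/
noncomputable def mono (c : Fin 2 →₀ ℕ) (φ : K⟦X⟧) : MvPowerSeries (Fin 2) K :=
  φ.subst (MvPowerSeries.monomial c (1 : K))

lemma nsmul_injective_of_ne_zero {c : Fin 2 →₀ ℕ} (hc : c ≠ 0) :
    Function.Injective fun k : ℕ => k • c := by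
  obtain ⟨i, hi⟩ := Finsupp.ne_iff.1 hc
  intro k k' h
  have := DFunLike.congr_fun h i
  simpa [show c i ≠ 0 from hi] using this

lemma coeff_mono {c : Fin 2 →₀ ℕ} (hc : c ≠ 0) (φ : K⟦X⟧) (d : Fin 2 →₀ ℕ) :
    MvPowerSeries.coeff d (mono c φ)
      = ∑ᶠ k : ℕ, if d = k • c then PowerSeries.coeff k φ else 0 := by
  rw [mono, PowerSeries.coeff_subst (.monomial hc 1)]
  refine finsum_congr fun k => ?_
  rw [MvPowerSeries.monomial_pow, MvPowerSeries.coeff_monomial]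
  simp

lemma coeff_mono_nsmul {c : Fin 2 →₀ ℕ} (hc : c ≠ 0) (φ : K⟦X⟧) (k : ℕ) :
    MvPowerSeries.coeff (k • c) (mono c φ) = PowerSeries.coeff k φ := by
  rw [coeff_mono hc, finsum_eq_single _ k, if_pos rfl]
  exact fun k' hk' => if_neg fun h => hk' (nsmul_injective_of_ne_zero hc h).symm

lemma coeff_mono_of_ne {c : Fin 2 →₀ ℕ} (hc : c ≠ 0) (φ : K⟦X⟧) {d : Fin 2 →₀ ℕ}
    (h : ∀ k : ℕ, d ≠ k • c) : MvPowerSeries.coeff d (mono c φ) = 0 := by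
  rw [coeff_mono hc]
  exact finsum_eq_zero_of_forall_eq_zero fun k => if_neg (h k)

lemma lcoeff_mono_nsmul {c : Fin 2 →₀ ℕ} (hc : c ≠ 0) (φ : K⟦X⟧) (k : ℕ) :
    lcoeff (mono c φ) (k • vec c) = PowerSeries.coeff k φ := by
  rw [← vec_nsmul, lcoeff_vec, coeff_mono_nsmul hc]

lemma lcoeff_mono_of_ne {c : Fin 2 →₀ ℕ} (hc : c ≠ 0) (φ : K⟦X⟧) {v : ℤ × ℤ}
    (h : ∀ k : ℕ, v ≠ k • vec c) : lcoeff (mono c φ) v = 0 := by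
  by_cases hv : 0 ≤ v
  · obtain ⟨d, rfl⟩ := exists_vec_eq hv
    rw [lcoeff_vec, coeff_mono_of_ne hc]
    rintro k rfl
    exact h k (vec_nsmul k c)
  · exact lcoeff_of_not_nonneg _ hv

lemma moves_mono {s : ℤ × ℤ ≃+ ℤ × ℤ} {c c' : Fin 2 →₀ ℕ} (hc : c ≠ 0) (hc' : c' ≠ 0)
    (h : s (vec c) = vec c') (φ : K⟦X⟧) : Moves s (mono c φ) (mono c' φ) := fun v => by
  by_cases hv : ∃ k : ℕ, v = k • vec c
  · obtain ⟨k, rfl⟩ := hv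
    rw [map_nsmul, h, lcoeff_mono_nsmul hc', lcoeff_mono_nsmul hc]
  · push Not at hv
    rw [lcoeff_mono_of_ne hc φ hv, lcoeff_mono_of_ne hc' φ]
    intro k hk
    rw [← h, ← map_nsmul] at hk
    exact hv k (s.injective hk)

lemma mono_mul {c : Fin 2 →₀ ℕ} (hc : c ≠ 0) (φ ψ : K⟦X⟧) :
    mono c (φ * ψ) = mono c φ * mono c ψ :=
  PowerSeries.subst_mul (.monomial hc 1) φ ψ

lemma mono_one {c : Fin 2 →₀ ℕ} (hc : c ≠ 0) : mono c (1 : K⟦X⟧) = 1 := by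
  rw [mono, ← PowerSeries.coe_substAlgHom (.monomial hc 1), map_one]

lemma map_mono {L : Type*} [CommRing L] (f : K →+* L) {c : Fin 2 →₀ ℕ} (hc : c ≠ 0) (φ : K⟦X⟧) :
    MvPowerSeries.map f (mono c φ) = mono c (PowerSeries.map f φ) := by
  ext d
  rw [MvPowerSeries.coeff_map]
  by_cases h : ∃ k : ℕ, d = k • c
  · obtain ⟨k, rfl⟩ := h
    rw [coeff_mono_nsmul hc, coeff_mono_nsmul hc, PowerSeries.coeff_map]
  · push Not at h
    rw [coeff_mono_of_ne hc _ h, coeff_mono_of_ne hc _ h, map_zero]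

lemma lcoeff_mul_mono (F : MvPowerSeries (Fin 2) K) {c : Fin 2 →₀ ℕ} (hc : c ≠ 0) (φ : K⟦X⟧)
    (v : ℤ × ℤ) : lcoeff (F * mono c φ) v
      = ∑ᶠ k : ℕ, lcoeff F (v - k • vec c) * PowerSeries.coeff k φ := by
  have hinj : Function.Injective fun k : ℕ => k • vec c := by
    simp only [← vec_nsmul]
    exact vec_injective.comp (nsmul_injective_of_ne_zero hc)
  rw [mul_comm F, lcoeff_mul]
  have hsupp : Function.support (fun u => lcoeff (mono c φ) u * lcoeff F (v - u))
      ⊆ Set.range fun k : ℕ => k • vec c := by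
    intro u hu
    by_contra h
    refine hu ?_
    simp only
    rw [lcoeff_mono_of_ne hc φ fun k hk => h ⟨k, hk.symm⟩, zero_mul]
  rw [← finsum_mem_univ, ← finsum_mem_inter_support, Set.univ_inter,
    ← Set.inter_eq_right.2 hsupp, finsum_mem_inter_support, finsum_mem_range hinj]
  refine finsum_congr fun k => ?_
  rw [lcoeff_mono_nsmul hc, mul_comm]

end Lattice

lemma zcoeff_mul {K : Type*} [Field K] (φ ψ : K⟦X⟧) (n : ℤ) :
    zcoeff (φ * ψ) n = ∑ᶠ k : ℕ, zcoeff φ (n - k) * PowerSeries.coeff k ψ := by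
  by_cases hn : 0 ≤ n
  · obtain ⟨n, rfl⟩ := Int.eq_ofNat_of_zero_le hn
    rw [zcoeff_natCast, mul_comm, PowerSeries.coeff_mul,
      Nat.sum_antidiagonal_eq_sum_range_succ_mk, finsum_eq_sum_range (N := n + 1)]
    · refine sum_congr rfl fun k hk => ?_
      rw [← Nat.cast_sub (Nat.lt_succ_iff.1 (mem_range.1 hk)), zcoeff_natCast, mul_comm]
    · intro k hk
      rw [zcoeff_of_neg _ (by omega), zero_mul]
  · rw [zcoeff_of_neg _ (by omega), finsum_eq_zero_of_forall_eq_zero]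
    intro k
    rw [zcoeff_of_neg _ (by omega), zero_mul]

section PairSeries

/-- The exponent `E(r, s)` attached to a pair of descending sequences. -/
noncomputable def pairExp (r s : ℕ → ℕ) : ℤ :=
  (∑ᶠ t : ℕ, (r t : ℤ) ^ 2) + (∑ᶠ t : ℕ, (s t : ℤ) ^ 2)
    - ∑ᶠ t : ℕ, (r t : ℤ) * ((s (3 * t) : ℤ) + (s (3 * t + 1) : ℤ) + (s (3 * t + 2) : ℤ))

lemma sum_range_three_mul {M : Type*} [AddCommMonoid M] (f : ℕ → M) (n : ℕ) :
    ∑ t ∈ range (3 * n), f t = ∑ t ∈ range n, (f (3 * t) + f (3 * t + 1) + f (3 * t + 2)) := by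
  induction n with
  | zero => simp
  | succ n ih =>
    rw [sum_range_succ, ← ih, Nat.mul_succ, sum_range_succ, sum_range_succ, sum_range_succ]
    simp only [add_assoc]

lemma pairExp_eq_left {a b : ℕ} {r s : ℕ → ℕ} (hr : r ∈ descOfSize a) (hs : s ∈ descOfSize b) :
    pairExp r s = ∑ t ∈ range a, ((r t : ℤ) ^ 2
        - ((s (3 * t) + s (3 * t + 1) + s (3 * t + 2) : ℕ) : ℤ) * r t)
      + ∑ t ∈ range b, (s t : ℤ) ^ 2 := by
  have h1 := fun t (ht : a ≤ t) => eq_zero_of_mem_descOfSize hr ht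
  have h2 := fun t (ht : b ≤ t) => eq_zero_of_mem_descOfSize hs ht
  rw [pairExp, finsum_eq_sum_range (N := a) fun t ht => by simp [h1 t ht],
    finsum_eq_sum_range (N := b) fun t ht => by simp [h2 t ht],
    finsum_eq_sum_range (N := a) fun t ht => by simp [h1 t ht], sum_sub_distrib,
    add_sub_right_comm]
  congr 2
  refine sum_congr rfl fun t _ => ?_
  push_cast; ring

lemma pairExp_eq_right {a b : ℕ} {r s : ℕ → ℕ} (hr : r ∈ descOfSize a) (hs : s ∈ descOfSize b) :
    pairExp r s = ∑ t ∈ range b, ((s t : ℤ) ^ 2 - ((r (t / 3) : ℕ) : ℤ) * s t)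
      + ∑ t ∈ range a, (r t : ℤ) ^ 2 := by
  have h1 := fun t (ht : a ≤ t) => eq_zero_of_mem_descOfSize hr ht
  have h2 := fun t (ht : b ≤ t) => eq_zero_of_mem_descOfSize hs ht
  rw [pairExp, finsum_eq_sum_range (N := a) fun t ht => by simp [h1 t ht],
    finsum_eq_sum_range (N := b) fun t ht => by simp [h2 t ht],
    finsum_eq_sum_range (N := max a b) fun t ht => by simp [h1 t (le_of_max_le_left ht)],
    sum_sub_distrib]
  have h3 : ∑ t ∈ range b, ((r (t / 3) : ℕ) : ℤ) * s t
      = ∑ t ∈ range (3 * max a b), ((r (t / 3) : ℕ) : ℤ) * s t :=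
    sum_subset (range_mono (by omega)) fun t _ ht => by simp [h2 t (by simpa using ht)]
  rw [h3, sum_range_three_mul]
  have h4 : ∀ t, (3 * t) / 3 = t ∧ (3 * t + 1) / 3 = t ∧ (3 * t + 2) / 3 = t := fun t => by omega
  simp only [h4, ← mul_add]
  ring

/-- The exponent `E(r, s)` is nonnegative. -/
lemma pairExp_nonneg {a b : ℕ} {r s : ℕ → ℕ} (hr : r ∈ descOfSize a) (hs : s ∈ descOfSize b) :
    0 ≤ pairExp r s := by
  have h1 := fun t (ht : a ≤ t) => eq_zero_of_mem_descOfSize hr ht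
  have h2 := fun t (ht : b ≤ t) => eq_zero_of_mem_descOfSize hs ht
  rw [pairExp, finsum_eq_sum_range (N := max a b) fun t ht => by simp [h1 t (le_of_max_le_left ht)],
    finsum_eq_sum_range (N := 3 * max a b) fun t ht => by simp [h2 t (by omega)],
    finsum_eq_sum_range (N := max a b) fun t ht => by simp [h1 t (le_of_max_le_left ht)],
    sum_range_three_mul, ← sum_add_distrib, ← sum_sub_distrib]
  refine sum_nonneg fun t _ => ?_
  nlinarith [sq_nonneg ((r t : ℤ) - 2 * s (3 * t)), sq_nonneg ((r t : ℤ) - 2 * s (3 * t + 1)),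
    sq_nonneg ((r t : ℤ) - 2 * s (3 * t + 2)), sq_nonneg (r t : ℤ)]

variable {K : Type*} [Field K] (q : K)

/-- The product `∏ 1 / (q;q)_{r_t - r_{t+1}}`. -/
noncomputable def seqPoch (r : ℕ → ℕ) : K := ∏ᶠ t, (qPoch q (r t - r (t + 1)))⁻¹

/-- The coefficient of `y₁ ^ a y₂ ^ b` in the sum over pairs of descending sequences. -/
noncomputable def pairCoeff (a b : ℕ) : K :=
  ∑ r ∈ descOfSize a, ∑ s ∈ descOfSize b, q ^ pairExp r s * seqPoch q r * seqPoch q s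

/-- The sum over pairs of descending sequences. -/
noncomputable def pairSeries : MvPowerSeries (Fin 2) K := fun d => pairCoeff q (d 0) (d 1)

variable {q}

lemma coeff_pairSeries (d : Fin 2 →₀ ℕ) :
    MvPowerSeries.coeff d (pairSeries q) = pairCoeff q (d 0) (d 1) := rfl

lemma seqWeight_eq {n : ℕ} {r : ℕ → ℕ} (hr : r ∈ descOfSize n) (m : ℕ → ℤ) :
    seqWeight q n m r = q ^ (∑ t ∈ range n, ((r t : ℤ) ^ 2 - m t * r t)) * seqPoch q r := by
  rw [seqWeight, seqPoch, finprod_eq_prod_range (N := n)]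
  intro t ht
  simp [eq_zero_of_mem_descOfSize hr ht, qPoch]

lemma mk_pairCoeff_left (hq0 : q ≠ 0) (b : ℕ) :
    PowerSeries.mk (fun a => pairCoeff q a b) = ∑ s ∈ descOfSize b,
      PowerSeries.C (q ^ (∑ t ∈ range b, (s t : ℤ) ^ 2) * seqPoch q s)
        * descSeries q (fun t => (s (3 * t) + s (3 * t + 1) + s (3 * t + 2) : ℕ)) := by
  ext a
  rw [PowerSeries.coeff_mk, map_sum, pairCoeff, sum_comm]
  refine sum_congr rfl fun s hs => ?_
  rw [PowerSeries.coeff_C_mul, descSeries, PowerSeries.coeff_mk, mul_sum]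
  refine sum_congr rfl fun r hr => ?_
  rw [seqWeight_eq hr, pairExp_eq_left hr hs, zpow_add₀ hq0]
  ring

lemma mk_pairCoeff_right (hq0 : q ≠ 0) (a : ℕ) :
    PowerSeries.mk (fun b => pairCoeff q a b) = ∑ r ∈ descOfSize a,
      PowerSeries.C (q ^ (∑ t ∈ range a, (r t : ℤ) ^ 2) * seqPoch q r)
        * descSeries q (fun t => (r (t / 3) : ℕ)) := by
  ext b
  rw [PowerSeries.coeff_mk, map_sum, pairCoeff]
  refine sum_congr rfl fun r hr => ?_
  rw [PowerSeries.coeff_C_mul, descSeries, PowerSeries.coeff_mk, mul_sum]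
  refine sum_congr rfl fun s hs => ?_
  rw [seqWeight_eq hs, pairExp_eq_right hr hs, zpow_add₀ hq0]
  ring

lemma zcoeff_sum {ι : Type*} (S : Finset ι) (φ : ι → K⟦X⟧) (n : ℤ) :
    zcoeff (∑ i ∈ S, φ i) n = ∑ i ∈ S, zcoeff (φ i) n := by
  simp only [zcoeff]; split_ifs <;> simp

lemma Palindromic.sum_C_mul {ι : Type*} {S : Finset ι} {c : ι → K} {φ : ι → K⟦X⟧} {ψ : K⟦X⟧}
    {D : ℤ} (h : ∀ i ∈ S, Palindromic D (φ i * ψ)) :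
    Palindromic D ((∑ i ∈ S, PowerSeries.C (c i) * φ i) * ψ) := fun n => by
  simp only [sum_mul, mul_assoc, zcoeff_sum, zcoeff_C_mul]
  exact sum_congr rfl fun i hi => by rw [h i hi n]

lemma palindromic_left [CharZero K] (hq0 : q ≠ 0) (hq : ∀ n : ℕ, q ^ (n + 1) ≠ 1) (b : ℕ) :
    Palindromic b (PowerSeries.mk (fun a => pairCoeff q a b) * (euler q)⁻¹) := by
  rw [mk_pairCoeff_left hq0]
  refine Palindromic.sum_C_mul fun s hs => ?_
  have h2 := fun t (ht : b ≤ t) => eq_zero_of_mem_descOfSize hs ht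
  have ha := antitone_of_mem_descOfSize hs
  convert palindromic_descSeries hq0 hq (T := b)
    (m := fun t => s (3 * t) + s (3 * t + 1) + s (3 * t + 2)) ?_ ?_ using 1
  · rw [← Nat.cast_sum, ← sum_range_three_mul, Nat.cast_inj, ← finsum_eq_sum_range,
      (mem_descOfSize.1 hs).2]
    exact fun t ht => h2 t (by omega)
  · exact fun t t' h => add_le_add (add_le_add (ha (by omega)) (ha (by omega))) (ha (by omega))
  · intro t ht
    simp [h2 (3 * t) (by omega), h2 (3 * t + 1) (by omega), h2 (3 * t + 2) (by omega)]

lemma palindromic_right [CharZero K] (hq0 : q ≠ 0) (hq : ∀ n : ℕ, q ^ (n + 1) ≠ 1) (a : ℕ) :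
    Palindromic (3 * a) (PowerSeries.mk (fun b => pairCoeff q a b) * (euler q)⁻¹) := by
  rw [mk_pairCoeff_right hq0]
  refine Palindromic.sum_C_mul fun r hr => ?_
  have h1 := fun t (ht : a ≤ t) => eq_zero_of_mem_descOfSize hr ht
  convert palindromic_descSeries hq0 hq (T := 3 * a) (m := fun t => r (t / 3)) ?_ ?_ using 1
  · have h4 : ∀ t, (3 * t) / 3 = t ∧ (3 * t + 1) / 3 = t ∧ (3 * t + 2) / 3 = t :=
      fun t => by omega
    have h5 := (finsum_eq_sum_range h1).symm.trans (mem_descOfSize.1 hr).2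
    rw [sum_range_three_mul]
    simp only [h4, sum_add_distrib]
    rw [← Nat.cast_sum, h5]
    ring
  · exact fun t t' h => antitone_of_mem_descOfSize hr (Nat.div_le_div_right h)
  · exact fun t ht => h1 _ (by omega)

lemma lcoeff_pairSeries_left (x : ℤ) (b : ℕ) : lcoeff (pairSeries q) (x, b)
    = zcoeff (PowerSeries.mk (fun a => pairCoeff q a b)) x := by
  simp [lcoeff, zcoeff, Prod.le_def, coeff_pairSeries]

lemma lcoeff_pairSeries_right (a : ℕ) (y : ℤ) : lcoeff (pairSeries q) (a, y)
    = zcoeff (PowerSeries.mk (fun b => pairCoeff q a b)) y := by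
  simp [lcoeff, zcoeff, Prod.le_def, coeff_pairSeries]

/-- The reflection in the long simple root. -/
def reflLong : ℤ × ℤ ≃+ ℤ × ℤ where
  toFun v := (v.2 - v.1, v.2)
  invFun v := (v.2 - v.1, v.2)
  left_inv v := by simp
  right_inv v := by simp
  map_add' v w := by ext <;> simp; ring

/-- The reflection in the short simple root. -/
def reflShort : ℤ × ℤ ≃+ ℤ × ℤ where
  toFun v := (v.1, 3 * v.1 - v.2)
  invFun v := (v.1, 3 * v.1 - v.2)
  left_inv v := by simp
  right_inv v := by simp
  map_add' v w := by ext <;> simp; ring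

lemma expo_ne_zero {a b : ℕ} (h : a ≠ 0 ∨ b ≠ 0) : expo a b ≠ 0 := fun h0 => by
  have h1 := DFunLike.congr_fun h0 0
  have h2 := DFunLike.congr_fun h0 1
  simp only [expo_zero, expo_one, Finsupp.coe_zero, Pi.zero_apply] at h1 h2
  omega

lemma vec_expo (a b : ℕ) : vec (expo a b) = ((a : ℤ), (b : ℤ)) := rfl

lemma moves_reflLong_pairSeries [CharZero K] (hq0 : q ≠ 0) (hq : ∀ n : ℕ, q ^ (n + 1) ≠ 1) :
    Moves reflLong (pairSeries q * mono (expo 1 0) (euler q)⁻¹)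
      (pairSeries q * mono (expo 1 0) (euler q)⁻¹) := by
  rintro ⟨x, y⟩
  change lcoeff _ (y - x, y) = _
  by_cases hy : 0 ≤ y
  · obtain ⟨b, rfl⟩ := Int.eq_ofNat_of_zero_le hy
    have key : ∀ x : ℤ, lcoeff (pairSeries q * mono (expo 1 0) (euler q)⁻¹) (x, b)
        = zcoeff (PowerSeries.mk (fun a => pairCoeff q a b) * (euler q)⁻¹) x := by
      intro x
      rw [lcoeff_mul_mono _ (expo_ne_zero (by simp)), zcoeff_mul]
      refine finsum_congr fun k => ?_
      rw [← lcoeff_pairSeries_left, vec_expo]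
      simp
    rw [key, key, palindromic_left hq0 hq b x]
  · rw [lcoeff_of_not_nonneg _ fun h => hy h.2, lcoeff_of_not_nonneg _ fun h => hy h.2]

lemma moves_reflShort_pairSeries [CharZero K] (hq0 : q ≠ 0) (hq : ∀ n : ℕ, q ^ (n + 1) ≠ 1) :
    Moves reflShort (pairSeries q * mono (expo 0 1) (euler q)⁻¹)
      (pairSeries q * mono (expo 0 1) (euler q)⁻¹) := by
  rintro ⟨x, y⟩
  change lcoeff _ (x, 3 * x - y) = _
  by_cases hx : 0 ≤ x
  · obtain ⟨a, rfl⟩ := Int.eq_ofNat_of_zero_le hx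
    have key : ∀ y : ℤ, lcoeff (pairSeries q * mono (expo 0 1) (euler q)⁻¹) (a, y)
        = zcoeff (PowerSeries.mk (fun b => pairCoeff q a b) * (euler q)⁻¹) y := by
      intro y
      rw [lcoeff_mul_mono _ (expo_ne_zero (by simp)), zcoeff_mul]
      refine finsum_congr fun k => ?_
      rw [← lcoeff_pairSeries_right, vec_expo]
      simp
    rw [key, key, palindromic_right hq0 hq a y]
  · rw [lcoeff_of_not_nonneg _ fun h => hx h.1, lcoeff_of_not_nonneg _ fun h => hx h.1]

lemma Moves.eq_C {F : MvPowerSeries (Fin 2) K} (h1 : Moves reflLong F F)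
    (h2 : Moves reflShort F F) : F = MvPowerSeries.C (MvPowerSeries.constantCoeff F) := by
  classical
  have hneg : ∀ v, lcoeff F (-v) = lcoeff F v := by
    intro v
    rw [← h1 v, ← h2 (reflLong v), ← h1 (reflShort _), ← h2 (reflLong _), ← h1 (reflShort _),
      ← h2 (reflLong _)]
    congr 1
    simp only [reflLong, reflShort, AddEquiv.coe_mk, Equiv.coe_fn_mk]
    ext <;> simp <;> ring
  ext d
  rw [MvPowerSeries.coeff_C]
  split_ifs with hd
  · rw [hd, MvPowerSeries.coeff_zero_eq_constantCoeff_apply]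
  · rw [← lcoeff_vec, ← hneg, lcoeff_of_not_nonneg]
    intro h
    have h3 : vec d = 0 := le_antisymm (neg_nonneg.1 h) (vec_nonneg d)
    exact hd (vec_injective (h3.trans (by simp [vec]; rfl)))

lemma constantCoeff_mono {c : Fin 2 →₀ ℕ} (hc : c ≠ 0) (φ : K⟦X⟧) :
    MvPowerSeries.constantCoeff (mono c φ) = PowerSeries.constantCoeff φ := by
  have := coeff_mono_nsmul hc φ 0
  rwa [zero_smul, MvPowerSeries.coeff_zero_eq_constantCoeff_apply,
    PowerSeries.coeff_zero_eq_constantCoeff_apply] at this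

lemma constantCoeff_pairSeries : MvPowerSeries.constantCoeff (pairSeries q) = 1 := by
  rw [← MvPowerSeries.coeff_zero_eq_constantCoeff_apply, coeff_pairSeries]
  simp [pairCoeff, descOfSize, descBox, pairExp, seqPoch, qPoch]

/-- The sum over pairs of descending sequences factors over the positive roots. -/
theorem pairSeries_eq_prod [CharZero K] (hq0 : q ≠ 0) (hq : ∀ n : ℕ, q ^ (n + 1) ≠ 1) :
    pairSeries q = mono (expo 1 0) (euler q) * mono (expo 0 1) (euler q)
      * mono (expo 1 1) (euler q) * mono (expo 1 2) (euler q) * mono (expo 1 3) (euler q)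
      * mono (expo 2 3) (euler q) := by
  set N := (euler q)⁻¹ with hN
  have h10 : expo 1 0 ≠ 0 := expo_ne_zero (by simp)
  have h01 : expo 0 1 ≠ 0 := expo_ne_zero (by simp)
  have h11 : expo 1 1 ≠ 0 := expo_ne_zero (by simp)
  have h12 : expo 1 2 ≠ 0 := expo_ne_zero (by simp)
  have h13 : expo 1 3 ≠ 0 := expo_ne_zero (by simp)
  have h23 : expo 2 3 ≠ 0 := expo_ne_zero (by simp)
  set R := pairSeries q * (mono (expo 1 0) N * mono (expo 0 1) N * mono (expo 1 1) N
    * mono (expo 1 2) N * mono (expo 1 3) N * mono (expo 2 3) N) with hR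
  have hlong : Moves reflLong R R := by
    have h := ((moves_reflLong_pairSeries hq0 hq).mul
      (moves_mono h01 h11 (show reflLong (vec (expo 0 1)) = vec (expo 1 1) from rfl) N)).mul
      (moves_mono h11 h01 (show reflLong (vec (expo 1 1)) = vec (expo 0 1) from rfl) N)
    have h' := ((h.mul
      (moves_mono h12 h12 (show reflLong (vec (expo 1 2)) = vec (expo 1 2) from rfl) N)).mul
      (moves_mono h13 h23 (show reflLong (vec (expo 1 3)) = vec (expo 2 3) from rfl) N)).mul
      (moves_mono h23 h13 (show reflLong (vec (expo 2 3)) = vec (expo 1 3) from rfl) N)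
    convert h' using 1 <;> rw [hR] <;> ring
  have hshort : Moves reflShort R R := by
    have h := ((moves_reflShort_pairSeries hq0 hq).mul
      (moves_mono h10 h13 (show reflShort (vec (expo 1 0)) = vec (expo 1 3) from rfl) N)).mul
      (moves_mono h13 h10 (show reflShort (vec (expo 1 3)) = vec (expo 1 0) from rfl) N)
    have h' := ((h.mul
      (moves_mono h23 h23 (show reflShort (vec (expo 2 3)) = vec (expo 2 3) from rfl) N)).mul
      (moves_mono h11 h12 (show reflShort (vec (expo 1 1)) = vec (expo 1 2) from rfl) N)).mul
      (moves_mono h12 h11 (show reflShort (vec (expo 1 2)) = vec (expo 1 1) from rfl) N)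
    convert h' using 1 <;> rw [hR] <;> ring
  have hN0 : PowerSeries.constantCoeff N = 1 := by
    rw [hN, PowerSeries.constantCoeff_inv]
    simp [euler, qPoch, ← PowerSeries.coeff_zero_eq_constantCoeff_apply]
  have hR1 : R = 1 := by
    rw [hlong.eq_C hshort, hR]
    simp only [map_mul, constantCoeff_pairSeries, constantCoeff_mono, h10, h01, h11, h12, h13,
      h23, hN0, ne_eq, not_false_eq_true, mul_one, map_one]
  have hinv : ∀ {c : Fin 2 →₀ ℕ}, c ≠ 0 → mono c (euler q) * mono c N = 1 := fun hc => by
    rw [← mono_mul hc, hN, euler_mul_inv, mono_one hc]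
  have e1 := hinv h10
  have e2 := hinv h01
  have e3 := hinv h11
  have e4 := hinv h12
  have e5 := hinv h13
  have e6 := hinv h23
  calc pairSeries q = pairSeries q * ((mono (expo 1 0) (euler q) * mono (expo 1 0) N)
        * (mono (expo 0 1) (euler q) * mono (expo 0 1) N)
        * (mono (expo 1 1) (euler q) * mono (expo 1 1) N)
        * (mono (expo 1 2) (euler q) * mono (expo 1 2) N)
        * (mono (expo 1 3) (euler q) * mono (expo 1 3) N)
        * (mono (expo 2 3) (euler q) * mono (expo 2 3) N)) := by
          rw [e1, e2, e3, e4, e5, e6]; simp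
    _ = R * (mono (expo 1 0) (euler q) * mono (expo 0 1) (euler q)
      * mono (expo 1 1) (euler q) * mono (expo 1 2) (euler q) * mono (expo 1 3) (euler q)
      * mono (expo 2 3) (euler q)) := by rw [hR]; ring
    _ = _ := by rw [hR1, one_mul]

end PairSeries

section Swap

/-- Power series with coefficients in `R[[y]]`, viewed as power series in `y` with coefficients
in `R[[X]]`. -/
noncomputable def swapFun {σ R : Type*} [CommRing R] (f : (MvPowerSeries σ R)⟦X⟧) :
    MvPowerSeries σ (R⟦X⟧) :=
  fun d => PowerSeries.mk fun n => MvPowerSeries.coeff d (PowerSeries.coeff n f)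

lemma coeff_coeff_swapFun {σ R : Type*} [CommRing R] (f : (MvPowerSeries σ R)⟦X⟧) (d : σ →₀ ℕ)
    (n : ℕ) : PowerSeries.coeff n (MvPowerSeries.coeff d (swapFun f))
      = MvPowerSeries.coeff d (PowerSeries.coeff n f) := by
  rw [MvPowerSeries.coeff_apply, swapFun, PowerSeries.coeff_mk]

/-- The ring homomorphism `R[[y]][[X]] → R[[X]][[y]]`. -/
noncomputable def swapHom (σ R : Type*) [CommRing R] :
    (MvPowerSeries σ R)⟦X⟧ →+* MvPowerSeries σ (R⟦X⟧) where
  toFun := swapFun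
  map_one' := by
    classical
    ext d n
    rw [coeff_coeff_swapFun, PowerSeries.coeff_one, MvPowerSeries.coeff_one]
    split_ifs with h1 h2 h2 <;> simp [MvPowerSeries.coeff_one, PowerSeries.coeff_one, h1, h2]
  map_mul' f g := by
    classical
    ext d n
    rw [coeff_coeff_swapFun, PowerSeries.coeff_mul, map_sum, MvPowerSeries.coeff_mul, map_sum]
    simp only [MvPowerSeries.coeff_mul, PowerSeries.coeff_mul, coeff_coeff_swapFun]
    rw [sum_comm]
  map_zero' := by
    ext d n
    rw [coeff_coeff_swapFun]
    simp
  map_add' f g := by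
    ext d n
    simp only [coeff_coeff_swapFun, map_add]

lemma coeff_coeff_swapHom {σ R : Type*} [CommRing R] (f : (MvPowerSeries σ R)⟦X⟧) (d : σ →₀ ℕ)
    (n : ℕ) : PowerSeries.coeff n (MvPowerSeries.coeff d (swapHom σ R f))
      = MvPowerSeries.coeff d (PowerSeries.coeff n f) :=
  coeff_coeff_swapFun f d n

/-- The power series in `q, y₁, y₂`, viewed as power series in `y₁, y₂` over `ℤ[[q]]`. -/
noncomputable def collect : MvPowerSeries (Fin 3) ℤ →+* MvPowerSeries (Fin 2) (ℤ⟦X⟧) :=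
  (swapHom (Fin 2) ℤ).comp (MvPowerSeries.finSuccEquiv ℤ 2 : MvPowerSeries (Fin 3) ℤ →+* _)

lemma coeff_coeff_collect (f : MvPowerSeries (Fin 3) ℤ) (d : Fin 2 →₀ ℕ) (n : ℕ) :
    PowerSeries.coeff n (MvPowerSeries.coeff d (collect f))
      = MvPowerSeries.coeff (d.cons n) f := by
  rw [← MvPowerSeries.coeff_coeff_finSuccEquiv]
  exact coeff_coeff_swapHom (MvPowerSeries.finSuccEquiv ℤ 2 f) d n

lemma collect_X_zero : collect (MvPowerSeries.X 0) = MvPowerSeries.C PowerSeries.X := by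
  classical
  ext d n
  change PowerSeries.coeff n (MvPowerSeries.coeff d
    (swapHom (Fin 2) ℤ (MvPowerSeries.finSuccEquiv ℤ 2 (MvPowerSeries.X 0)))) = _
  rw [MvPowerSeries.finSuccEquiv_X_zero, coeff_coeff_swapHom, MvPowerSeries.coeff_C,
    PowerSeries.coeff_X]
  split_ifs with h1 h2 h2 <;> simp [MvPowerSeries.coeff_one, PowerSeries.coeff_X, h1, h2]

lemma collect_X_succ (i : Fin 2) : collect (MvPowerSeries.X i.succ) = MvPowerSeries.X i := by
  classical
  ext d n
  change PowerSeries.coeff n (MvPowerSeries.coeff d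
    (swapHom (Fin 2) ℤ (MvPowerSeries.finSuccEquiv ℤ 2 (MvPowerSeries.X i.succ)))) = _
  rw [MvPowerSeries.finSuccEquiv_X_succ, coeff_coeff_swapHom, PowerSeries.coeff_C,
    MvPowerSeries.coeff_X]
  split_ifs with h1 h2 h2 <;> simp [MvPowerSeries.coeff_X, PowerSeries.coeff_one, h1, h2]

lemma single_add_single_eq_expo (a b : ℕ) :
    Finsupp.single (0 : Fin 2) a + Finsupp.single 1 b = expo a b := by
  ext i
  fin_cases i <;> simp

lemma collect_prod_X_pow (c : Fin 2 → ℕ) :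
    collect (∏ i : Fin 2, MvPowerSeries.X i.succ ^ c i)
      = MvPowerSeries.monomial (expo (c 0) (c 1)) 1 := by
  rw [Fin.prod_univ_two, map_mul, map_pow, map_pow, collect_X_succ, collect_X_succ,
    MvPowerSeries.X_pow_eq, MvPowerSeries.X_pow_eq, MvPowerSeries.monomial_mul_monomial, mul_one,
    single_add_single_eq_expo]

end Swap

section IntegralEuler

/-- The `q`-Pochhammer symbol `(q;q)_n` in `ℤ[[q]]`. -/
noncomputable def intPoch (n : ℕ) : ℤ⟦X⟧ := ∏ i ∈ range n, (1 - PowerSeries.X ^ (i + 1))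

lemma isUnit_intPoch (n : ℕ) : IsUnit (intPoch n) := by
  rw [PowerSeries.isUnit_iff_constantCoeff, intPoch, map_prod]
  simp

/-- The product `∏_{n > N} (1 - q ^ n X)⁻¹`, as a power series in `X` over `ℤ[[q]]`. -/
noncomputable def intEuler (N : ℕ) : ℤ⟦X⟧⟦X⟧ :=
  PowerSeries.mk fun k => PowerSeries.X ^ ((N + 1) * k) * Ring.inverse (intPoch k)

lemma intEuler_succ (N : ℕ) :
    (1 - PowerSeries.C (PowerSeries.X ^ (N + 1)) * PowerSeries.X) * intEuler N
      = intEuler (N + 1) := by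
  ext1 k
  cases k with
  | zero => simp [sub_mul, mul_assoc, intEuler]
  | succ k =>
    have h1 := Ring.mul_inverse_cancel _ (isUnit_intPoch k)
    have h2 := Ring.mul_inverse_cancel _ (isUnit_intPoch (k + 1))
    have h3 : intPoch (k + 1) = intPoch k * (1 - PowerSeries.X ^ (k + 1)) := prod_range_succ _ _
    simp only [sub_mul, one_mul, mul_assoc, map_sub, PowerSeries.coeff_C_mul,
      PowerSeries.coeff_succ_X_mul, intEuler, PowerSeries.coeff_mk]
    have h4 : Ring.inverse (intPoch k)
        = (1 - PowerSeries.X ^ (k + 1)) * Ring.inverse (intPoch (k + 1)) := by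
      linear_combination Ring.inverse (intPoch (k + 1)) * Ring.inverse (intPoch k) * h3
        - Ring.inverse (intPoch k) * h2
        + (1 - PowerSeries.X ^ (k + 1)) * Ring.inverse (intPoch (k + 1)) * h1
    rw [h4]
    ring

lemma prod_mul_intEuler (N : ℕ) :
    (∏ n ∈ range N, (1 - PowerSeries.C (PowerSeries.X ^ (n + 1)) * PowerSeries.X)) * intEuler 0
      = intEuler N := by
  induction N with
  | zero => simp
  | succ N ih => rw [prod_range_succ, mul_right_comm, ih, mul_comm, intEuler_succ]

lemma exists_intEuler_eq (N : ℕ) :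
    ∃ φ, intEuler N = 1 + PowerSeries.C (PowerSeries.X ^ (N + 1)) * φ := by
  refine ⟨PowerSeries.mk fun k => if k = 0 then 0 else
    PowerSeries.X ^ ((N + 1) * (k - 1)) * Ring.inverse (intPoch k), ?_⟩
  ext1 k
  rw [map_add, PowerSeries.coeff_C_mul, PowerSeries.coeff_mk, PowerSeries.coeff_one, intEuler,
    PowerSeries.coeff_mk]
  rcases k with _ | k
  · simp [intPoch]
  · simp [Nat.mul_succ, pow_add]
    ring

lemma map_ringInverse {R S : Type*} [CommRing R] [CommRing S] (f : R →+* S) {a : R}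
    (ha : IsUnit a) : f (Ring.inverse a) = Ring.inverse (f a) := by
  obtain ⟨u, rfl⟩ := ha
  rw [Ring.inverse_unit, show f (u : R) = (Units.map (f : R →* S) u : S) from rfl,
    Ring.inverse_unit]
  rfl

lemma map_intPoch {K : Type*} [Field K] (f : ℤ⟦X⟧ →+* K) (n : ℕ) :
    f (intPoch n) = qPoch (f PowerSeries.X) n := by
  simp [intPoch, qPoch, map_prod]

lemma map_intEuler {K : Type*} [Field K] (f : ℤ⟦X⟧ →+* K) :
    PowerSeries.map f (intEuler 0) = euler (f PowerSeries.X) := by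
  ext k
  rw [PowerSeries.coeff_map, intEuler, euler, PowerSeries.coeff_mk, PowerSeries.coeff_mk, map_mul,
    map_ringInverse f (isUnit_intPoch k), map_intPoch, Ring.inverse_eq_inv', map_pow, zero_add,
    one_mul]

end IntegralEuler

section InfiniteProduct

open Filter Topology

/-- The factor `1 - q ^ (n + 1) y ^ c`. -/
noncomputable def rootFactor (c : Fin 2 → ℕ) (n : ℕ) : MvPowerSeries (Fin 3) ℤ :=
  1 - MvPowerSeries.X 0 ^ (n + 1) * ∏ i : Fin 2, MvPowerSeries.X i.succ ^ c i

lemma isUnit_rootFactor (c : Fin 2 → ℕ) (n : ℕ) : IsUnit (rootFactor c n) := by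
  rw [MvPowerSeries.isUnit_iff_constantCoeff, rootFactor]
  simp

lemma collect_rootFactor {c : Fin 2 → ℕ} (hc : expo (c 0) (c 1) ≠ 0) (n : ℕ) :
    collect (rootFactor c n) = mono (expo (c 0) (c 1))
      (1 - PowerSeries.C (PowerSeries.X ^ (n + 1)) * PowerSeries.X) := by
  have hs := PowerSeries.HasSubst.monomial hc (1 : ℤ⟦X⟧)
  rw [rootFactor, map_sub, map_mul, map_pow, collect_X_zero, collect_prod_X_pow, map_one, mono,
    PowerSeries.subst_sub hs, PowerSeries.subst_mul hs, PowerSeries.subst_C,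
    PowerSeries.subst_X hs, ← mono, mono_one hc, map_pow]

lemma multipliable_inverse_rootFactor (c : Fin 2 → ℕ) :
    Multipliable fun n => Ring.inverse (rootFactor c n) := by
  have h : ∀ n, Ring.inverse (rootFactor c n) = 1 + MvPowerSeries.X 0 ^ (n + 1)
      * ((∏ i : Fin 2, MvPowerSeries.X i.succ ^ c i) * Ring.inverse (rootFactor c n)) := by
    intro n
    have := Ring.mul_inverse_cancel _ (isUnit_rootFactor c n)
    rw [rootFactor] at this ⊢
    linear_combination this
  rw [funext h]
  refine MvPowerSeries.WithPiTopology.multipliable_one_add_of_tendsto_order_atTop_nhds_top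
    (tendsto_nhds_top_mono (f := fun n : ℕ => (n : ℕ∞)) ?_ (Eventually.of_forall fun n => ?_))
  · exact ENat.tendsto_nhds_top_iff_natCast_lt.2 fun n =>
      (eventually_gt_atTop n).mono fun a ha => by exact_mod_cast ha
  · have h1 := MvPowerSeries.le_order_pow_of_constantCoeff_eq_zero (n + 1)
      (f := (MvPowerSeries.X 0 : MvPowerSeries (Fin 3) ℤ)) (by simp)
    refine le_trans ?_ MvPowerSeries.le_order_mul
    refine le_trans ?_ le_self_add
    refine le_trans ?_ h1
    change (n : ℕ∞) ≤ ((n + 1 : ℕ) : ℕ∞)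
    exact_mod_cast n.le_succ

lemma collect_tprod {c : Fin 2 → ℕ} (hc : expo (c 0) (c 1) ≠ 0) :
    collect (∏' n, Ring.inverse (rootFactor c n)) = mono (expo (c 0) (c 1)) (intEuler 0) := by
  have hlim := (multipliable_inverse_rootFactor c).hasProd.tendsto_prod_nat
  ext d n
  rw [coeff_coeff_collect]
  have hev := (MvPowerSeries.WithPiTopology.tendsto_iff_coeff_tendsto _ _ _).1 hlim (d.cons n)
  rw [nhds_discrete, tendsto_pure] at hev
  obtain ⟨N, hN, hnN⟩ := (hev.and (eventually_ge_atTop n)).exists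
  rw [← hN, ← coeff_coeff_collect]
  have h1 : collect (∏ i ∈ range N, Ring.inverse (rootFactor c i))
      * collect (∏ i ∈ range N, rootFactor c i) = 1 := by
    rw [← map_mul, ← prod_mul_distrib, prod_congr rfl fun i _ =>
      Ring.inverse_mul_cancel _ (isUnit_rootFactor c i), prod_const_one, map_one]
  have h2 : collect (∏ i ∈ range N, rootFactor c i) * mono (expo (c 0) (c 1)) (intEuler 0)
      = mono (expo (c 0) (c 1)) (intEuler N) := by
    have h := PowerSeries.HasSubst.monomial hc (1 : ℤ⟦X⟧)
    rw [← prod_mul_intEuler N, mono_mul hc, map_prod, mono, mono,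
      ← PowerSeries.coe_substAlgHom h, map_prod]
    simp only [collect_rootFactor hc, mono, PowerSeries.coe_substAlgHom h]
  obtain ⟨φ, hφ⟩ := exists_intEuler_eq N
  have h3 : mono (expo (c 0) (c 1)) (intEuler N)
      = 1 + MvPowerSeries.C (PowerSeries.X ^ (N + 1)) * mono (expo (c 0) (c 1)) φ := by
    have h := PowerSeries.HasSubst.monomial hc (1 : ℤ⟦X⟧)
    rw [hφ, mono, PowerSeries.subst_add h, PowerSeries.subst_mul h, PowerSeries.subst_C, ← mono,
      ← mono, mono_one hc]
  set Q := collect (∏ i ∈ range N, Ring.inverse (rootFactor c i))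
  have h4 : mono (expo (c 0) (c 1)) (intEuler 0)
      = Q + MvPowerSeries.C (PowerSeries.X ^ (N + 1)) * (Q * mono (expo (c 0) (c 1)) φ) := by
    linear_combination (-mono (expo (c 0) (c 1)) (intEuler 0)) * h1 + Q * h2 + Q * h3
  rw [h4, map_add, MvPowerSeries.coeff_C_mul, map_add, PowerSeries.coeff_X_pow_mul',
    if_neg (by omega), add_zero]

end InfiniteProduct

section FractionField

/-- The field of fractions of `ℤ[[q]]`. -/
abbrev QField : Type := FractionRing ℤ⟦X⟧

/-- The inclusion of `ℤ[[q]]` in its field of fractions. -/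
noncomputable abbrev toQField : ℤ⟦X⟧ →+* QField := algebraMap ℤ⟦X⟧ QField

lemma toQField_injective : Function.Injective toQField := IsFractionRing.injective ℤ⟦X⟧ QField

/-- The variable `q`, as an element of the field of fractions. -/
noncomputable abbrev qVar : QField := toQField PowerSeries.X

instance : CharZero QField :=
  charZero_of_injective_ringHom (f := toQField.comp PowerSeries.C)
    (toQField_injective.comp PowerSeries.C_injective)

lemma qVar_ne_zero : qVar ≠ 0 := fun h =>
  PowerSeries.X_ne_zero (toQField_injective (h.trans (map_zero _).symm))

lemma qVar_pow_ne_one (n : ℕ) : qVar ^ (n + 1) ≠ 1 := fun h => by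
  rw [← map_pow, ← map_one toQField] at h
  simpa using congrArg PowerSeries.constantCoeff (toQField_injective h)

/-- Power series in `q, y₁, y₂`, viewed as power series in `y₁, y₂` over the field of fractions
of `ℤ[[q]]`. -/
noncomputable def collectField : MvPowerSeries (Fin 3) ℤ →+* MvPowerSeries (Fin 2) QField :=
  (MvPowerSeries.map toQField).comp collect

lemma coeff_collectField (f : MvPowerSeries (Fin 3) ℤ) (d : Fin 2 →₀ ℕ) :
    MvPowerSeries.coeff d (collectField f) = toQField (MvPowerSeries.coeff d (collect f)) := by
  rw [collectField, RingHom.comp_apply, MvPowerSeries.coeff_map]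

lemma collectField_X_zero : collectField (MvPowerSeries.X 0) = MvPowerSeries.C qVar := by
  rw [collectField, RingHom.comp_apply, collect_X_zero, MvPowerSeries.map_C]

lemma collectField_prod_X_pow (c : Fin 2 → ℕ) :
    collectField (∏ i : Fin 2, MvPowerSeries.X i.succ ^ c i)
      = MvPowerSeries.monomial (expo (c 0) (c 1)) 1 := by
  rw [collectField, RingHom.comp_apply, collect_prod_X_pow, MvPowerSeries.map_monomial, map_one]

lemma collectField_tprod {c : Fin 2 → ℕ} (hc : expo (c 0) (c 1) ≠ 0) :
    collectField (∏' n, Ring.inverse (rootFactor c n))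
      = mono (expo (c 0) (c 1)) (euler qVar) := by
  rw [collectField, RingHom.comp_apply, collect_tprod hc, map_mono _ hc, map_intEuler]

lemma collectField_prod_posRoots :
    collectField (∏ c ∈ posRootsG2, ∏' n, Ring.inverse (rootFactor c n)) = pairSeries qVar := by
  rw [pairSeries_eq_prod qVar_ne_zero qVar_pow_ne_one, map_prod,
    prod_congr rfl fun c hc => collectField_tprod (c := c) (expo_ne_zero ?_)]
  · rw [posRootsG2, prod_insert (by decide), prod_insert (by decide), prod_insert (by decide),
      prod_insert (by decide), prod_insert (by decide), prod_singleton]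
    simp only [Matrix.cons_val_zero, Matrix.cons_val_one, mul_assoc]
  · revert c
    decide

/-- The factor `1 / (q;q)_m` in `ℤ[[q, y₁, y₂]]`. -/
noncomputable def invPoch (m : ℕ) : MvPowerSeries (Fin 3) ℤ :=
  Ring.inverse (∏ u ∈ range m, (1 - MvPowerSeries.X 0 ^ (u + 1)))

lemma collectField_invPoch (m : ℕ) :
    collectField (invPoch m) = MvPowerSeries.C (qPoch qVar m)⁻¹ := by
  have hu : IsUnit
      (∏ u ∈ range m, (1 - (MvPowerSeries.X 0 : MvPowerSeries (Fin 3) ℤ) ^ (u + 1))) := by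
    rw [MvPowerSeries.isUnit_iff_constantCoeff, map_prod]
    simp
  have hq : IsUnit (qPoch qVar m) := by
    rw [isUnit_iff_ne_zero, qPoch, prod_ne_zero_iff]
    exact fun i _ => sub_ne_zero.2 (qVar_pow_ne_one i).symm
  rw [invPoch, map_ringInverse _ hu, ← Ring.inverse_eq_inv', map_ringInverse _ hq, qPoch, map_prod,
    map_prod]
  simp only [map_sub, map_one, map_pow, collectField_X_zero]

lemma collectField_finprod_invPoch {r : ℕ → ℕ} {N : ℕ} (hr : ∀ t ≥ N, r t = 0) :
    collectField (∏ᶠ j, invPoch (r j - r (j + 1))) = MvPowerSeries.C (seqPoch qVar r) := by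
  rw [seqPoch, finprod_eq_prod_range (N := N) fun t ht => by simp [hr t ht, invPoch],
    finprod_eq_prod_range (N := N) fun t ht => by simp [hr t ht, qPoch], map_prod, map_prod]
  simp only [collectField_invPoch]

/-- The term of the sum side attached to a pair of sequences. -/
noncomputable def pairTerm (r : Fin 2 → ℕ → ℕ) : MvPowerSeries (Fin 3) ℤ :=
  MvPowerSeries.X 0 ^ (pairExp (r 0) (r 1)).toNat
    * (∏ i : Fin 2, MvPowerSeries.X i.succ ^ (∑ᶠ t : ℕ, r i t))
    * ∏ i : Fin 2, ∏ᶠ j, invPoch (r i j - r i (j + 1))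

lemma pairExp_nonneg_of_isDescending {r s : ℕ → ℕ} (hr : IsDescending r) (hs : IsDescending s) :
    0 ≤ pairExp r s :=
  pairExp_nonneg (mem_descOfSize.2 ⟨hr, rfl⟩) (mem_descOfSize.2 ⟨hs, rfl⟩)

lemma coeff_collectField_pairTerm {r : Fin 2 → ℕ → ℕ} (hr : ∀ i, IsDescending (r i))
    (d : Fin 2 →₀ ℕ) : MvPowerSeries.coeff d (collectField (pairTerm r))
      = if d = expo (∑ᶠ t, r 0 t) (∑ᶠ t, r 1 t) then
          qVar ^ pairExp (r 0) (r 1) * seqPoch qVar (r 0) * seqPoch qVar (r 1) else 0 := by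
  classical
  obtain ⟨N0, h0⟩ := (hr 0).2
  obtain ⟨N1, h1⟩ := (hr 1).2
  have hE : qVar ^ (pairExp (r 0) (r 1)).toNat = qVar ^ pairExp (r 0) (r 1) := by
    rw [← zpow_natCast, Int.toNat_of_nonneg (pairExp_nonneg_of_isDescending (hr 0) (hr 1))]
  rw [pairTerm, map_mul collectField, map_mul collectField, map_pow, collectField_X_zero,
    collectField_prod_X_pow, Fin.prod_univ_two, map_mul collectField,
    collectField_finprod_invPoch h0, collectField_finprod_invPoch h1,
    ← map_pow, ← map_mul, mul_right_comm, ← map_mul, MvPowerSeries.coeff_C_mul,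
    MvPowerSeries.coeff_monomial, hE, mul_ite, mul_one, mul_zero, mul_assoc]

lemma sum_piFinset_descOfSize {M : Type*} [AddCommMonoid M] (d : Fin 2 → ℕ)
    (f : (ℕ → ℕ) → (ℕ → ℕ) → M) :
    ∑ r ∈ Fintype.piFinset fun i => descOfSize (d i), f (r 0) (r 1)
      = ∑ r ∈ descOfSize (d 0), ∑ s ∈ descOfSize (d 1), f r s := by
  rw [← sum_product']
  refine sum_nbij' (fun r => (r 0, r 1)) (fun p => ![p.1, p.2]) ?_ ?_ ?_ ?_ ?_
  · intro r hr
    rw [Fintype.mem_piFinset] at hr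
    exact mem_product.2 ⟨hr 0, hr 1⟩
  · intro p hp
    rw [mem_product] at hp
    simpa [Fintype.mem_piFinset, Fin.forall_fin_two] using hp
  · intro r _
    ext i
    fin_cases i <;> rfl
  · intro p _
    rfl
  · intro r _
    rfl

lemma sum_coeff_collect_pairTerm (d : Fin 2 →₀ ℕ) :
    ∑ r ∈ Fintype.piFinset fun i => descOfSize (d i), MvPowerSeries.coeff d (collect (pairTerm r))
      = MvPowerSeries.coeff d
          (collect (∏ c ∈ posRootsG2, ∏' n, Ring.inverse (rootFactor c n))) := by
  apply toQField_injective
  rw [← coeff_collectField, collectField_prod_posRoots, coeff_pairSeries, pairCoeff,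
    ← sum_piFinset_descOfSize (fun i => d i)
      (fun r s => qVar ^ pairExp r s * seqPoch qVar r * seqPoch qVar s), map_sum]
  refine sum_congr rfl fun r hr => ?_
  have h := fun i => mem_descOfSize.1 (Fintype.mem_piFinset.1 hr i)
  rw [← coeff_collectField, coeff_collectField_pairTerm fun i => (h i).1, if_pos]
  rw [(h 0).2, (h 1).2, expo_apply]

lemma coeff_pairTerm_eq_zero {r : Fin 2 → ℕ → ℕ} (hr : ∀ i, IsDescending (r i)) {d : Fin 2 →₀ ℕ}
    (hd : r ∉ Fintype.piFinset fun i => descOfSize (d i)) :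
    MvPowerSeries.coeff d (collect (pairTerm r)) = 0 := by
  apply toQField_injective
  rw [← coeff_collectField, coeff_collectField_pairTerm hr, map_zero, if_neg]
  rintro rfl
  refine hd (Fintype.mem_piFinset.2 fun i => mem_descOfSize.2 ⟨hr i, ?_⟩)
  fin_cases i <;> rfl

theorem hasSum_pairTerm :
    HasSum (fun r : {r : Fin 2 → ℕ → ℕ // ∀ i, IsDescending (r i)} => pairTerm r.1)
      (∏ c ∈ posRootsG2, ∏' n, Ring.inverse (rootFactor c n)) := by
  classical
  generalize hT : ∏ c ∈ posRootsG2, ∏' n, Ring.inverse (rootFactor c n) = T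
  refine Pi.hasSum.2 fun e => ?_
  change HasSum (fun r : {r : Fin 2 → ℕ → ℕ // ∀ i, IsDescending (r i)} =>
    MvPowerSeries.coeff e (pairTerm r.1)) (MvPowerSeries.coeff e T)
  rw [← Finsupp.cons_tail e]
  simp only [← coeff_coeff_collect]
  rw [← hT, ← sum_coeff_collect_pairTerm, map_sum]
  set S := Fintype.piFinset fun i => descOfSize (e.tail i)
  have hS : ∀ r ∈ S, ∀ i, IsDescending (r i) := fun r hr i =>
    (mem_descOfSize.1 (Fintype.mem_piFinset.1 hr i)).1
  rw [← Finset.sum_subtype_of_mem (fun r => PowerSeries.coeff (e 0)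
    (MvPowerSeries.coeff e.tail (collect (pairTerm r)))) hS]
  refine hasSum_sum_of_ne_finset_zero fun r hr => ?_
  rw [coeff_pairTerm_eq_zero r.2 (fun h => hr (mem_subtype.2 h)), map_zero]

end FractionField

end G2Identity

open MvPowerSeries

/-- The identity of Theorem 7.3 in type `G₂`.  In `ℤ[[q, y₁, y₂]]`
(variables indexed by `Fin 3`, `q = X 0`, `yᵢ = X i.succ`):
`∏_{c ∈ Φ⁺} ∏_{n ≥ 1} (1 - qⁿ y₁^{c₁} y₂^{c₂})⁻¹
  = ∑_{(r₁,r₂) descending} q^{E r} y₁^{|r₁|} y₂^{|r₂|}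
      ∏_{i=1}^{2} ∏_{j ≥ 1} (q;q)_{rᵢ^{(j)}-rᵢ^{(j+1)}}⁻¹`,
with `E r = ∑_{t≥1} (r₁^{(t)})² + ∑_{t≥1} (r₂^{(t)})²
 - ∑_{t≥1} r₁^{(t)} (r₂^{(3t-2)} + r₂^{(3t-1)} + r₂^{(3t)})`, a nonnegative integer. -/
theorem stmt_13
    (E : (Fin 2 → ℕ → ℕ) → ℤ)
    (hE : ∀ r : Fin 2 → ℕ → ℕ, E r =
      (∑ᶠ t : ℕ, (r 0 t : ℤ) ^ 2) + (∑ᶠ t : ℕ, (r 1 t : ℤ) ^ 2)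
        - ∑ᶠ t : ℕ, (r 0 t : ℤ)
            * ((r 1 (3 * t) : ℤ) + (r 1 (3 * t + 1) : ℤ) + (r 1 (3 * t + 2) : ℤ))) :
    (∀ r : Fin 2 → ℕ → ℕ, (∀ i, IsDescending (r i)) → 0 ≤ E r)
    ∧ (∏ c ∈ posRootsG2, ∏' n : ℕ,
          Ring.inverse (1 - (X 0 : MvPowerSeries (Fin 3) ℤ) ^ (n + 1)
            * ∏ i : Fin 2, (X i.succ : MvPowerSeries (Fin 3) ℤ) ^ c i))
      = ∑' r : {r : Fin 2 → ℕ → ℕ // ∀ i, IsDescending (r i)},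
          (X 0 : MvPowerSeries (Fin 3) ℤ) ^ (E r.1).toNat
            * (∏ i : Fin 2, (X i.succ : MvPowerSeries (Fin 3) ℤ) ^ (∑ᶠ t : ℕ, r.1 i t))
            * ∏ i : Fin 2, ∏ᶠ j : ℕ,
                Ring.inverse (∏ u ∈ Finset.range (r.1 i j - r.1 i (j + 1)),
                  (1 - (X 0 : MvPowerSeries (Fin 3) ℤ) ^ (u + 1))) := by
  have hE' : ∀ r, E r = G2Identity.pairExp (r 0) (r 1) := hE
  refine ⟨fun r hr => ?_, ?_⟩
  · rw [hE']
    exact G2Identity.pairExp_nonneg_of_isDescending (hr 0) (hr 1)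
  · have : T2Space (MvPowerSeries (Fin 3) ℤ) := inferInstanceAs (T2Space ((Fin 3 →₀ ℕ) → ℤ))
    simp only [hE']
    exact G2Identity.hasSum_pairTerm.tsum_eq.symm
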